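/- arXiv:2008.10500 — 4 statements merged into one kernel-verified Lean document; each statement's English description precedes it below -/
import Mathlib

section
/- Let α > 1 be an irrational real number. Then as t → 0⁺, L_α(t) = π²/(6αt) + ((1 − α^{−1})/2)·log t + o(|log t|). -/
open Filter Topology Real Asymptotics

/-- `L_α(t) = -∑_{ℓ ≥ 1} log(1 - e^{-t⌊αℓ⌋})`. -/
noncomputable def LBeatty (α : ℝ) (t : ℝ) : ℝ :=
  -∑' ℓ : ℕ, Real.log (1 - Real.exp (-t * (⌊α * (ℓ + 1)⌋ : ℤ)))

lemma fract_sum_rat (p : ℤ) (q : ℕ) (hq : 0 < q) (hc : IsCoprime p (q:ℤ)) (γ : ℝ) :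
    ∃ θ : ℝ, 0 ≤ θ ∧ θ < 1 ∧
      ∑ j ∈ Finset.range q, Int.fract (γ + j * (p / q : ℝ)) = ((q:ℝ) - 1) / 2 + θ := by
  have hq0 : (0:ℝ) < q := by exact_mod_cast hq
  have hqz : (0:ℤ) < q := by exact_mod_cast hq
  refine ⟨Int.fract (q * γ), Int.fract_nonneg _, Int.fract_lt_one _, ?_⟩
  set θ := Int.fract (q * γ) with hθ
  set m : ℤ := ⌊q * γ⌋ with hm
  have hmθ : (q:ℝ) * γ = m + θ := (Int.floor_add_fract _).symm
  have key : ∀ j : ℕ, Int.fract (γ + j * (p / q : ℝ)) =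
      ((((m + j * p) % (q:ℤ)).toNat : ℕ) : ℝ) / q + θ / q := by
    intro j
    have h1 := Int.emod_nonneg (m + j * p) hqz.ne'
    have h2 := Int.emod_lt_of_pos (m + j * p) hqz
    have h3 : ((((m + j * p) % (q:ℤ)).toNat : ℕ) : ℝ) = (((m + j * p) % (q:ℤ) : ℤ) : ℝ) := by
      have := Int.toNat_of_nonneg h1
      exact_mod_cast congrArg (fun z : ℤ => (z:ℝ)) this
    rw [h3, Int.fract_eq_iff]
    have h1' : (0:ℝ) ≤ (((m + j * p) % (q:ℤ) : ℤ) : ℝ) := by exact_mod_cast h1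
    have h2' : (((m + j * p) % (q:ℤ) : ℤ) : ℝ) + 1 ≤ q := by
      have : (m + j * p) % (q:ℤ) + 1 ≤ q := h2
      exact_mod_cast this
    have t0 : 0 ≤ θ := Int.fract_nonneg _
    have t1 : θ < 1 := Int.fract_lt_one _
    refine ⟨by positivity, ?_, (m + j * p) / (q:ℤ), ?_⟩
    · rw [← add_div, div_lt_one hq0]; linarith
    · have h4 := Int.emod_add_mul_ediv (m + j * p) (q:ℤ)
      have h5 : (((m + j * p) % (q:ℤ) : ℤ) : ℝ) + q * (((m + j * p) / (q:ℤ) : ℤ) : ℝ)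
        = m + j * p := by exact_mod_cast h4
      field_simp
      linarith
  rw [Finset.sum_congr rfl (fun j _ => key j), Finset.sum_add_distrib]
  have hbij : ∑ j ∈ Finset.range q, ((((m + j * p) % (q:ℤ)).toNat : ℕ) : ℝ) / q
      = ∑ r ∈ Finset.range q, (r:ℝ) / q := by
    have hmaps : ∀ j ∈ Finset.range q, ((m + j * p) % (q:ℤ)).toNat ∈ Finset.range q := by
      intro j _
      have h1 := Int.emod_nonneg (m + j * p) hqz.ne'
      have h2 := Int.emod_lt_of_pos (m + j * p) hqz
      rw [Finset.mem_range]; omega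
    have hinj : Set.InjOn (fun j : ℕ => ((m + j * p) % (q:ℤ)).toNat) (Finset.range q) := by
      intro i hi j hj hij
      have hi' := Finset.mem_range.1 (Finset.mem_coe.1 hi)
      have hj' := Finset.mem_range.1 (Finset.mem_coe.1 hj)
      have h1 := Int.emod_nonneg (m + i * p) hqz.ne'
      have h2 := Int.emod_nonneg (m + j * p) hqz.ne'
      have h3 : (m + i * p) % (q:ℤ) = (m + j * p) % (q:ℤ) := by
        simp only at hij; omega
      have h4 : (q:ℤ) ∣ (m + j * p) - (m + i * p) := Int.ModEq.dvd h3
      have h5 : (q:ℤ) ∣ ((j:ℤ) - i) * p := by convert h4 using 1; ring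
      have h6 : (q:ℤ) ∣ (j:ℤ) - i := hc.symm.dvd_of_dvd_mul_right h5
      have h7 : (j:ℤ) - i = 0 := by
        apply Int.eq_zero_of_abs_lt_dvd h6
        rw [abs_lt]; omega
      omega
    have himg : (Finset.range q).image (fun j : ℕ => ((m + j * p) % (q:ℤ)).toNat)
        = Finset.range q := by
      apply Finset.eq_of_subset_of_card_le
      · intro x hx
        obtain ⟨j, hj, rfl⟩ := Finset.mem_image.1 hx
        exact hmaps j hj
      · rw [Finset.card_image_of_injOn hinj]
    conv_rhs => rw [← himg]
    rw [Finset.sum_image hinj]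
  rw [hbij, ← Finset.sum_div]
  have hg : ∀ n : ℕ, ∑ r ∈ Finset.range n, (r:ℝ) = n * (n - 1) / 2 := by
    intro n
    induction n with
    | zero => simp
    | succ n ih => rw [Finset.sum_range_succ, ih]; push_cast; ring
  rw [hg]
  simp only [Finset.sum_const, Finset.card_range, nsmul_eq_mul]
  field_simp

lemma block_bound (α β : ℝ) (p : ℤ) (q : ℕ) (hq : 0 < q) (hc : IsCoprime p (q:ℤ))
    (h : |α - p / q| ≤ 1 / ((q:ℝ) * q)) :
    |∑ j ∈ Finset.range q, (Int.fract (β + j * α) - 1 / 2)| ≤ 3 := by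
  have hq0 : (0:ℝ) < q := by exact_mod_cast hq
  have hd : ∀ j ∈ Finset.range q, |(j:ℝ) * α - j * (p / q : ℝ)| ≤ 1 / q := by
    intro j hj
    have hj' : (j:ℝ) ≤ q := by exact_mod_cast (Finset.mem_range.1 hj).le
    rw [← mul_sub, abs_mul, Nat.abs_cast]
    calc (j:ℝ) * |α - p / q| ≤ q * (1 / ((q:ℝ) * q)) := by gcongr
      _ = 1 / q := by field_simp
  have hlo : ∀ j ∈ Finset.range q,
      Int.fract ((β + 1 / q) + j * (p / q : ℝ)) - 2 / q ≤ Int.fract (β + j * α) := by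
    intro j hj
    have h1 := abs_le.1 (hd j hj)
    have h2 : ⌊β + j * α⌋ ≤ ⌊(β + 1 / q) + j * (p / q : ℝ)⌋ := Int.floor_mono (by linarith [h1.2])
    have h3 : ((⌊β + j * α⌋ : ℤ) : ℝ) ≤ ((⌊(β + 1 / q) + j * (p / q : ℝ)⌋ : ℤ) : ℝ) := by
      exact_mod_cast h2
    have e : (2:ℝ) / q = 1 / q + 1 / q := by ring
    unfold Int.fract
    linarith [h1.1]
  have hhi : ∀ j ∈ Finset.range q,
      Int.fract (β + j * α) ≤ Int.fract ((β - 1 / q) + j * (p / q : ℝ)) + 2 / q := by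
    intro j hj
    have h1 := abs_le.1 (hd j hj)
    have h2 : ⌊(β - 1 / q) + j * (p / q : ℝ)⌋ ≤ ⌊β + j * α⌋ := Int.floor_mono (by linarith [h1.1])
    have h3 : ((⌊(β - 1 / q) + j * (p / q : ℝ)⌋ : ℤ) : ℝ) ≤ ((⌊β + j * α⌋ : ℤ) : ℝ) := by
      exact_mod_cast h2
    have e : (2:ℝ) / q = 1 / q + 1 / q := by ring
    unfold Int.fract
    linarith [h1.2]
  obtain ⟨θ, a0, a1, ha⟩ := fract_sum_rat p q hq hc (β + 1 / q)
  obtain ⟨θ', b0, b1, hb⟩ := fract_sum_rat p q hq hc (β - 1 / q)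
  have s1 := Finset.sum_le_sum hlo
  have s2 := Finset.sum_le_sum hhi
  rw [Finset.sum_sub_distrib, ha] at s1
  rw [Finset.sum_add_distrib, hb] at s2
  rw [Finset.sum_sub_distrib]
  simp only [Finset.sum_const, Finset.card_range, nsmul_eq_mul] at s1 s2 ⊢
  have e : (q:ℝ) * (2 / q) = 2 := by field_simp
  rw [e] at s1 s2
  rw [abs_le]; constructor <;> linarith

lemma exists_large_den (α : ℝ) (hirr : Irrational α) (D : ℕ) :
    ∃ (p : ℤ) (q : ℕ), D < q ∧ IsCoprime p (q:ℤ) ∧ |α - p / q| ≤ 1 / ((q:ℝ) * q) := by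
  have h1 := hirr.eventually_forall_le_dist_cast_rat_of_den_le D
  have h2 : Tendsto (fun n : ℕ => 1 / ((n:ℝ) + 1)) atTop (𝓝 0) :=
    tendsto_one_div_add_atTop_nhds_zero_nat
  obtain ⟨n, hn⟩ := (h2.eventually h1).exists
  obtain ⟨r, hr, hrd⟩ := Real.exists_rat_abs_sub_le_and_den_le α (show 0 < n + 1 by omega)
  have hd0 : (0:ℝ) < r.den := by exact_mod_cast r.den_pos
  have hd1 : (1:ℝ) ≤ r.den := by exact_mod_cast r.den_pos
  have hnd : (r.den:ℝ) ≤ n + 1 := by exact_mod_cast hrd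
  refine ⟨r.num, r.den, ?_, ?_, ?_⟩
  · by_contra hcon
    have := hn r (by omega)
    rw [Real.dist_eq] at this
    have hn0 : (0:ℝ) ≤ n := Nat.cast_nonneg n
    have h5 : 1 / ((((n + 1 : ℕ):ℝ) + 1) * r.den) < 1 / ((n:ℝ) + 1) := by
      apply one_div_lt_one_div_of_lt (by positivity)
      push_cast
      nlinarith
    linarith
  · rw [Int.isCoprime_iff_gcd_eq_one]
    exact r.reduced
  · have e : ((r.num:ℝ) / r.den) = (r:ℝ) := by exact_mod_cast r.num_div_den
    rw [e]
    refine hr.trans ?_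
    apply one_div_le_one_div_of_le (by positivity)
    push_cast
    nlinarith

lemma fract_sum_bound (α : ℝ) (hirr : Irrational α) (ε : ℝ) (hε : 0 < ε) :
    ∃ K : ℝ, 0 ≤ K ∧ ∀ N : ℕ,
      |∑ l ∈ Finset.range N, (Int.fract (α * (l + 1)) - 1 / 2)| ≤ ε * N + K := by
  obtain ⟨D, hD⟩ := exists_nat_gt (3 / ε)
  obtain ⟨p, q, hDq, hc, hpq⟩ := exists_large_den α hirr D
  have hq : 0 < q := by omega
  have hDq' : (D:ℝ) < q := by exact_mod_cast hDq
  have h3 : 3 ≤ ε * q := by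
    rw [div_lt_iff₀ hε] at hD; nlinarith
  refine ⟨q, by positivity, ?_⟩
  intro N
  induction N using Nat.strong_induction_on with
  | _ N ih =>
    by_cases hN : N < q
    · have hN' : (N:ℝ) ≤ q := by exact_mod_cast hN.le
      calc _ ≤ ∑ l ∈ Finset.range N, |Int.fract (α * (l + 1)) - 1 / 2| :=
            Finset.abs_sum_le_sum_abs _ _
        _ ≤ ∑ l ∈ Finset.range N, (1:ℝ) := by
            apply Finset.sum_le_sum
            intro l _
            rw [abs_le]
            constructor <;> linarith [Int.fract_nonneg (α * ((l:ℝ) + 1)), Int.fract_lt_one (α * ((l:ℝ) + 1))]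
        _ = N := by simp
        _ ≤ _ := by have : 0 ≤ ε * N := by positivity
                    linarith
    · obtain ⟨M, rfl⟩ : ∃ M, N = M + q := ⟨N - q, by omega⟩
      rw [Finset.sum_range_add]
      have i1 := ih M (by omega)
      have i2 := block_bound α (α * (M + 1)) p q hq hc hpq
      have e : ∑ x ∈ Finset.range q, (Int.fract (α * (((M + x : ℕ):ℝ) + 1)) - 1 / 2)
          = ∑ j ∈ Finset.range q, (Int.fract (α * (M + 1) + j * α) - 1 / 2) := by
        apply Finset.sum_congr rfl
        intro x _
        congr 2; push_cast; ring
      rw [e]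
      refine (abs_add_le _ _).trans ?_
      push_cast
      nlinarith

lemma abel_cesaro (b : ℕ → ℝ) 
    (hS : ∀ ε > 0, ∃ K : ℝ, 0 ≤ K ∧ ∀ N : ℕ, |∑ l ∈ Finset.range N, b l| ≤ ε * N + K) :
    Tendsto (fun r : ℝ => (1 - r) * ∑' l, b l * r ^ l) (𝓝[<] 1) (𝓝 0) := by
  have main : ∀ ε > 0, ∀ K : ℝ, 0 ≤ K → (∀ N : ℕ, |∑ l ∈ Finset.range N, b l| ≤ ε * N + K) →
      ∀ r : ℝ, 0 < r → r < 1 → |(1 - r) * ∑' l, b l * r ^ l| ≤ ε + K * (1 - r) := by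
    intro ε hε K hK hKN r hr0 hr1
    have h1r : 0 < 1 - r := by linarith
    set S : ℕ → ℝ := fun N => ∑ l ∈ Finset.range N, b l with hSdef
    have hg := hasSum_geometric_of_lt_one hr0.le hr1
    have hng := hasSum_coe_mul_geometric_of_norm_lt_one (𝕜 := ℝ) (r := r)
      (by rw [Real.norm_eq_abs, abs_of_pos hr0]; exact hr1)
    have hmaj : HasSum (fun l : ℕ => (ε * ((l + 1 : ℕ):ℝ) + K) * r ^ l)
        (ε * (r / (1 - r) ^ 2) + (ε + K) * (1 - r)⁻¹) := by
      refine ((hng.mul_left ε).add (hg.mul_left (ε + K))).congr_fun ?_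
      intro l; push_cast; ring
    have hbd : ∀ l : ℕ, ‖S (l + 1) * r ^ l‖ ≤ (ε * ((l + 1 : ℕ):ℝ) + K) * r ^ l := by
      intro l
      rw [norm_mul, Real.norm_eq_abs, Real.norm_eq_abs, abs_of_pos (pow_pos hr0 l)]
      exact mul_le_mul_of_nonneg_right (hKN (l + 1)) (pow_pos hr0 l).le
    have hsum : Summable (fun l : ℕ => S (l + 1) * r ^ l) :=
      Summable.of_norm_bounded hmaj.summable hbd
    have hT := hsum.hasSum
    set T := ∑' l : ℕ, S (l + 1) * r ^ l with hTdef
    have hT2 : HasSum (fun l : ℕ => S l * r ^ l) (r * T) := by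
      rw [← hasSum_nat_add_iff' 1]
      simp only [Finset.range_one, Finset.sum_singleton]
      have : S 0 = 0 := by simp [hSdef]
      rw [this, zero_mul, sub_zero]
      refine (hT.mul_left r).congr_fun ?_
      intro l; rw [pow_succ]; ring
    have hF : HasSum (fun l : ℕ => b l * r ^ l) (T - r * T) := by
      refine (hT.sub hT2).congr_fun ?_
      intro l
      have : S (l + 1) = S l + b l := by simp [hSdef, Finset.sum_range_succ]
      rw [this]; ring
    rw [hF.tsum_eq]
    have hTb : |T| ≤ ε * (r / (1 - r) ^ 2) + (ε + K) * (1 - r)⁻¹ := by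
      have := tsum_of_norm_bounded hmaj hbd
      rwa [Real.norm_eq_abs] at this
    have e1 : (1 - r) * (T - r * T) = (1 - r) ^ 2 * T := by ring
    rw [e1, abs_mul, abs_of_pos (by positivity)]
    calc (1 - r) ^ 2 * |T| ≤ (1 - r) ^ 2 * (ε * (r / (1 - r) ^ 2) + (ε + K) * (1 - r)⁻¹) := by
          gcongr
      _ = ε + K * (1 - r) := by field_simp; ring
  rw [Metric.tendsto_nhdsWithin_nhds]
  intro ε hε
  obtain ⟨K, hK, hKN⟩ := hS (ε / 2) (by linarith)
  refine ⟨min 1 (ε / (2 * (K + 1))), by positivity, ?_⟩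
  intro r hr hd
  have hr1 : r < 1 := hr
  rw [Real.dist_eq, abs_sub_comm, abs_of_pos (by linarith)] at hd
  have d1 := lt_of_lt_of_le hd (min_le_left _ _)
  have d2 := lt_of_lt_of_le hd (min_le_right _ _)
  have := main (ε / 2) (by linarith) K hK hKN r (by linarith) hr1
  rw [Real.dist_eq, sub_zero]
  refine lt_of_le_of_lt this ?_
  rw [lt_div_iff₀ (by positivity)] at d2
  nlinarith

lemma inv_exp_bound (y : ℝ) (hy : 0 < y) (hy1 : y ≤ 1) :
    |1 / (exp y - 1) - 1 / y + 1 / 2| ≤ 2 * y := by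
  have h := Real.exp_bound (x := y) (by rw [abs_of_pos hy]; exact hy1) (n := 3) (by norm_num)
  simp only [Finset.sum_range_succ, Finset.sum_range_zero, abs_of_pos hy] at h
  norm_num [Nat.factorial] at h
  have he : y ≤ exp y - 1 := by linarith [Real.add_one_le_exp y]
  set e := exp y - 1 with hedef
  obtain ⟨ρ, hρ⟩ : ∃ ρ, ρ = e - y - y ^ 2 / 2 := ⟨_, rfl⟩
  have hy3 : 0 < y ^ 3 := by positivity
  have hρ1 : |ρ| ≤ y ^ 3 := by
    have : ρ = exp y - (1 + y + y ^ 2 / 2) := by rw [hρ, hedef]; ring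
    rw [this]; refine h.trans ?_; linarith
  have he0 : 0 < e := by linarith
  have e1 : 1 / e - 1 / y + 1 / 2 = (-2 * ρ + y ^ 3 / 2 + y * ρ) / (2 * (y * e)) := by
    have : e = ρ + y + y ^ 2 / 2 := by rw [hρ]; ring
    have h2 : 1 / e - 1 / y + 1 / 2 = (2 * y - 2 * e + y * e) / (2 * (y * e)) := by
      field_simp
    rw [h2]; congr 1; rw [this]; ring
  rw [e1, abs_div, abs_of_pos (show 0 < 2 * (y * e) by positivity), div_le_iff₀ (by positivity)]
  have n1 : |-2 * ρ + y ^ 3 / 2 + y * ρ| ≤ 4 * y ^ 3 := by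
    have a := abs_le.1 hρ1
    have b : |y * ρ| ≤ y ^ 3 := by
      rw [abs_mul, abs_of_pos hy]
      calc y * |ρ| ≤ 1 * |ρ| := by gcongr
        _ ≤ y ^ 3 := by linarith
    have b' := abs_le.1 b
    rw [abs_le]; constructor <;> linarith [a.1, a.2, b'.1, b'.2]
  refine n1.trans ?_
  have : y * y ≤ y * e := by gcongr
  nlinarith

/-- The generating function `∑ e^{-x⌊αℓ⌋}`. -/
noncomputable def Gb (α x : ℝ) : ℝ := ∑' l : ℕ, Real.exp (-x * (⌊α * (l + 1)⌋ : ℤ))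

lemma floor_ge (α : ℝ) (hα : 1 < α) (l : ℕ) : (l:ℝ) + 1 ≤ ((⌊α * (l + 1)⌋ : ℤ):ℝ) := by
  have : ((l:ℤ) + 1) ≤ ⌊α * ((l:ℝ) + 1)⌋ := by
    rw [Int.le_floor]; push_cast
    nlinarith [(Nat.cast_nonneg l : (0:ℝ) ≤ l)]
  exact_mod_cast this

lemma hasSum_exp (x : ℝ) (hx : 0 < x) :
    HasSum (fun l : ℕ => exp (-x) * exp (-x) ^ l) (1 / (exp x - 1)) := by
  have h := (hasSum_geometric_of_lt_one (exp_pos (-x)).le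
    (by rw [Real.exp_lt_one_iff]; linarith : exp (-x) < 1)).mul_left (exp (-x))
  have h1 : 1 < exp x := Real.one_lt_exp_iff.2 hx
  have : exp x - 1 ≠ 0 := by linarith
  have h3 : 1 - (exp x)⁻¹ ≠ 0 := by
    have : (exp x)⁻¹ < 1 := inv_lt_one_of_one_lt₀ h1
    linarith
  have e : exp (-x) * (1 - exp (-x))⁻¹ = 1 / (exp x - 1) := by
    rw [Real.exp_neg]
    field_simp
  rw [e] at h
  exact h

lemma Gb_term_le (α : ℝ) (hα : 1 < α) (x : ℝ) (hx : 0 < x) (l : ℕ) :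
    Real.exp (-x * (⌊α * (l + 1)⌋ : ℤ)) ≤ exp (-x) * exp (-x) ^ l := by
  rw [← Real.exp_nat_mul, ← Real.exp_add, Real.exp_le_exp]
  nlinarith [floor_ge α hα l]

lemma Gb_summable (α : ℝ) (hα : 1 < α) (x : ℝ) (hx : 0 < x) :
    Summable (fun l : ℕ => Real.exp (-x * (⌊α * (l + 1)⌋ : ℤ))) :=
  Summable.of_nonneg_of_le (fun _ => (exp_pos _).le) (Gb_term_le α hα x hx) (hasSum_exp x hx).summable

lemma Gb_bounds (α : ℝ) (hα : 1 < α) (x : ℝ) (hx : 0 < x) : 0 ≤ Gb α x ∧ Gb α x ≤ 1 / x := by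
  constructor
  · exact tsum_nonneg (fun _ => (exp_pos _).le)
  · have h := (Gb_summable α hα x hx).tsum_le_tsum (Gb_term_le α hα x hx) (hasSum_exp x hx).summable
    rw [(hasSum_exp x hx).tsum_eq] at h
    refine le_trans h ?_
    apply one_div_le_one_div_of_le hx
    linarith [Real.add_one_le_exp x]

lemma Gb_approx (α : ℝ) (hα : 1 < α) (x : ℝ) (hx : 0 < x) (hx1 : x ≤ 1) :
    |Gb α x - (1 + x / 2) * (1 / (exp (α * x) - 1))
      - x * exp (-(α * x)) * ∑' l : ℕ, (Int.fract (α * (l + 1)) - 1 / 2) * exp (-(α * x)) ^ l|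
      ≤ x ^ 2 * (1 / (exp (α * x) - 1)) := by
  have hy : 0 < α * x := by positivity
  have hE := hasSum_exp (α * x) hy
  have hG := (Gb_summable α hα x hx).hasSum
  set r := exp (-(α * x)) with hr
  have hr0 : 0 < r := exp_pos _
  have hB : Summable (fun l : ℕ => (Int.fract (α * ((l:ℝ) + 1)) - 1 / 2) * r ^ l) := by
    refine Summable.of_norm_bounded (g := fun l : ℕ => r ^ l) ?_ ?_
    · exact summable_geometric_of_lt_one hr0.le (by rw [hr, Real.exp_lt_one_iff]; linarith)
    · intro l
      rw [norm_mul, Real.norm_eq_abs, Real.norm_eq_abs, abs_of_pos (pow_pos hr0 l)]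
      refine mul_le_of_le_one_left (pow_pos hr0 l).le ?_
      rw [abs_le]
      constructor <;> linarith [Int.fract_nonneg (α * ((l:ℝ) + 1)), Int.fract_lt_one (α * ((l:ℝ) + 1))]
  have hD := (hG.sub (hE.mul_left (1 + x / 2))).sub (hB.hasSum.mul_left (x * r))
  have hM := hE.mul_left (x ^ 2)
  have hfin := tsum_of_norm_bounded hM (f := fun l : ℕ => Real.exp (-x * (⌊α * (l + 1)⌋ : ℤ))
    - (1 + x / 2) * (r * r ^ l) - x * r * ((Int.fract (α * ((l:ℝ) + 1)) - 1 / 2) * r ^ l)) ?_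
  · rw [hD.tsum_eq, Real.norm_eq_abs] at hfin
    exact hfin
  · intro l
    set a := Int.fract (α * ((l:ℝ) + 1)) with ha
    have a0 : 0 ≤ a := Int.fract_nonneg _
    have a1 : a < 1 := Int.fract_lt_one _
    have e1 : Real.exp (-x * (⌊α * ((l:ℝ) + 1)⌋ : ℤ)) = r * r ^ l * exp (x * a) := by
      rw [hr, ← Real.exp_nat_mul, ← Real.exp_add, ← Real.exp_add]
      congr 1
      have : ((⌊α * ((l:ℝ) + 1)⌋ : ℤ):ℝ) = α * (l + 1) - a := by
        rw [ha]; unfold Int.fract; ring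
      rw [this]; ring
    have e2 : Real.exp (-x * (⌊α * ((l:ℝ) + 1)⌋ : ℤ))
        - (1 + x / 2) * (r * r ^ l) - x * r * ((a - 1 / 2) * r ^ l)
        = r * r ^ l * (exp (x * a) - 1 - x * a) := by rw [e1]; ring
    have hp : 0 < r * r ^ l := by positivity
    have hxa : x * a ≤ x := by nlinarith
    have hxa0 : 0 ≤ x * a := by positivity
    rw [e2, norm_mul, Real.norm_eq_abs, Real.norm_eq_abs, abs_of_pos hp, mul_comm]
    refine mul_le_mul_of_nonneg_right ?_ hp.le
    refine (Real.abs_exp_sub_one_sub_id_le ?_).trans ?_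
    · rw [abs_of_nonneg hxa0]; linarith
    · gcongr

lemma Gb_tendsto (α : ℝ) (hα : 1 < α) (hirr : Irrational α) :
    Tendsto (fun x => Gb α x - 1 / (α * x)) (𝓝[>] 0) (𝓝 (-((1 - α⁻¹) / 2))) := by
  have hα0 : 0 < α := by linarith
  have hx0 : Tendsto (fun x : ℝ => x) (𝓝[>] 0) (𝓝 0) := tendsto_nhdsWithin_of_tendsto_nhds tendsto_id
  have hpos : ∀ᶠ x : ℝ in 𝓝[>] 0, 0 < x := eventually_mem_nhdsWithin
  have hsmall : ∀ᶠ x : ℝ in 𝓝[>] 0, x ≤ 1 ∧ α * x ≤ 1 := by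
    have : ∀ᶠ x : ℝ in 𝓝[>] 0, x < min 1 (1 / α) := hx0.eventually_lt_const (by positivity)
    filter_upwards [this] with x hx
    refine ⟨(lt_of_lt_of_le hx (min_le_left _ _)).le, ?_⟩
    have := lt_of_lt_of_le hx (min_le_right _ _)
    rw [lt_div_iff₀ hα0] at this; linarith
  -- g(αx) - 1/(αx) → -1/2
  have L1 : Tendsto (fun x => 1 / (exp (α * x) - 1) - 1 / (α * x)) (𝓝[>] 0) (𝓝 (-(1/2))) := by
    have : Tendsto (fun x => 1 / (exp (α * x) - 1) - 1 / (α * x) + 1 / 2) (𝓝[>] 0) (𝓝 0) := by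
      refine squeeze_zero_norm' (a := fun x => 2 * (α * x)) ?_ ?_
      · filter_upwards [hpos, hsmall] with x h1 h2
        exact inv_exp_bound (α * x) (by positivity) h2.2
      · simpa using (hx0.const_mul α).const_mul 2
    have h2 := this.add_const (-(1/2))
    rw [zero_add] at h2
    refine h2.congr ?_
    intro x; ring
  -- x g(αx) → 1/α
  have L2 : Tendsto (fun x => x * (1 / (exp (α * x) - 1))) (𝓝[>] 0) (𝓝 α⁻¹) := by
    have h := (hx0.mul L1).add_const α⁻¹
    rw [zero_mul, zero_add] at h
    refine h.congr' ?_
    filter_upwards [hpos] with x hx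
    have : x * (1 / (α * x)) = α⁻¹ := by field_simp
    rw [mul_sub, this]; ring
  have L3 : Tendsto (fun x => x ^ 2 * (1 / (exp (α * x) - 1))) (𝓝[>] 0) (𝓝 0) := by
    have h := hx0.mul L2
    rw [zero_mul] at h
    refine h.congr ?_
    intro x; ring
  have hr1 : Tendsto (fun x => exp (-(α * x))) (𝓝[>] 0) (𝓝[<] 1) := by
    rw [tendsto_nhdsWithin_iff]
    constructor
    · have : Tendsto (fun x => exp (-(α * x))) (𝓝[>] 0) (𝓝 (exp (-(α * 0)))) :=
        (Real.continuous_exp.tendsto _).comp ((hx0.const_mul α).neg)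
      simpa using this
    · filter_upwards [hpos] with x hx
      show exp (-(α * x)) < 1
      rw [Real.exp_lt_one_iff]
      have : 0 < α * x := by positivity
      linarith
  have hAb := (abel_cesaro (fun l : ℕ => Int.fract (α * ((l:ℝ) + 1)) - 1 / 2) 
    (fun ε hε => fract_sum_bound α hirr ε hε)).comp hr1
  have L4 : Tendsto (fun x => x * exp (-(α * x)) *
      ∑' l : ℕ, (Int.fract (α * (l + 1)) - 1 / 2) * exp (-(α * x)) ^ l) (𝓝[>] 0) (𝓝 0) := by
    have h := L2.mul hAb
    rw [mul_zero] at h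
    refine h.congr' ?_
    filter_upwards [hpos] with x hx
    have hy : 0 < α * x := by positivity
    have h1 : 1 < exp (α * x) := Real.one_lt_exp_iff.2 hy
    have h2 : exp (α * x) - 1 ≠ 0 := by linarith
    have h3 : 1 / (exp (α * x) - 1) * (1 - exp (-(α * x))) = exp (-(α * x)) := by
      rw [Real.exp_neg]; field_simp
    simp only [Function.comp]
    rw [← h3]
    rw [h3]
    rw [mul_assoc x, ← mul_assoc (1 / (exp (α * x) - 1)), h3]
    ring
  have L5 : Tendsto (fun x => Gb α x - (1 + x / 2) * (1 / (exp (α * x) - 1))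
      - x * exp (-(α * x)) * ∑' l : ℕ, (Int.fract (α * (l + 1)) - 1 / 2) * exp (-(α * x)) ^ l)
      (𝓝[>] 0) (𝓝 0) := by
    refine squeeze_zero_norm' ?_ L3
    filter_upwards [hpos, hsmall] with x h1 h2
    exact Gb_approx α hα x h1 h2.1
  have h := ((L5.add L4).add L1).add (L2.div_const 2)
  have e : (0:ℝ) + 0 + -(1/2) + α⁻¹ / 2 = -((1 - α⁻¹) / 2) := by ring
  rw [e] at h
  refine h.congr ?_
  intro x; ring

lemma LBeatty_eq (α : ℝ) (hα : 1 < α) (t : ℝ) (ht : 0 < t) :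
    HasSum (fun k : ℕ => Gb α ((k + 1) * t) / (k + 1)) (LBeatty α t) := by
  set y : ℕ → ℝ := fun l => Real.exp (-t * (⌊α * ((l:ℝ) + 1)⌋ : ℤ)) with hy
  have hy0 : ∀ l, 0 < y l := fun l => exp_pos _
  have het : exp (-t) < 1 := by rw [Real.exp_lt_one_iff]; linarith
  have hyt : ∀ l, y l ≤ exp (-t) := by
    intro l
    refine (Gb_term_le α hα t ht l).trans ?_
    exact mul_le_of_le_one_right (exp_pos _).le (pow_le_one₀ (exp_pos _).le het.le)
  have hlog : ∀ l, HasSum (fun k : ℕ => y l ^ (k + 1) / ((k:ℝ) + 1)) (-log (1 - y l)) := by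
    intro l
    apply Real.hasSum_pow_div_log_of_abs_lt_one
    rw [abs_of_pos (hy0 l)]; linarith [hyt l]
  have hlogs : Summable (fun l => -log (1 - y l)) := by
    refine Summable.of_nonneg_of_le (f := fun l => y l * (1 - exp (-t))⁻¹) ?_ ?_
      ((Gb_summable α hα t ht).mul_right _)
    · intro l
      have := Real.log_nonpos (x := 1 - y l) (by linarith [hyt l]) (by linarith [hy0 l])
      linarith
    · intro l
      have h1 : 0 < 1 - y l := by linarith [hyt l]
      have h2 := Real.one_sub_inv_le_log_of_pos h1
      have h3 : (1 - y l)⁻¹ - 1 = y l * (1 - y l)⁻¹ := by field_simp; ring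
      have h4 : (1 - y l)⁻¹ ≤ (1 - exp (-t))⁻¹ :=
        inv_anti₀ (by linarith) (by linarith [hyt l])
      have h5 := mul_le_mul_of_nonneg_left h4 (hy0 l).le
      linarith
  have hprod : Summable (Function.uncurry (fun l k : ℕ => y l ^ (k + 1) / ((k:ℝ) + 1))) := by
    rw [summable_prod_of_nonneg]
    · refine ⟨fun l => (hlog l).summable, ?_⟩
      refine hlogs.congr ?_
      intro l; exact (hlog l).tsum_eq.symm
    · rintro ⟨l, k⟩
      have := hy0 l
      simp only [Function.uncurry, Pi.zero_apply]
      positivity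
  have hk : ∀ k : ℕ, ∑' l, y l ^ (k + 1) / ((k:ℝ) + 1) = Gb α ((k + 1) * t) / (k + 1) := by
    intro k
    rw [tsum_div_const]
    congr 1
    unfold Gb
    congr 1
    funext l
    rw [hy]
    simp only
    rw [← Real.exp_nat_mul]
    congr 1; push_cast; ring
  have hL : LBeatty α t = ∑' k : ℕ, Gb α ((k + 1) * t) / (k + 1) := by
    unfold LBeatty
    rw [← tsum_neg, ← tsum_congr hk, hprod.tsum_comm]
    exact tsum_congr (fun l => (hlog l).tsum_eq.symm)
  rw [hL]
  apply Summable.hasSum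
  have := hprod.prod_symm.prod
  refine this.congr ?_
  intro k
  exact hk k

lemma tail_hasSum (N : ℕ) :
    HasSum (fun k : ℕ => 2 / (((k + N : ℕ):ℝ) + 1) - 2 / (((k + 1 + N : ℕ):ℝ) + 1)) (2 / ((N:ℝ) + 1)) := by
  have h0 : Tendsto (fun k : ℕ => 2 / (((k + N : ℕ):ℝ) + 1)) atTop (𝓝 0) := by
    have h1 := (tendsto_one_div_add_atTop_nhds_zero_nat (𝕜 := ℝ)).const_mul 2
    rw [mul_zero] at h1
    have h2 := h1.comp (tendsto_add_atTop_nat N)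
    refine h2.congr ?_
    intro k; simp only [Function.comp]; ring
  rw [hasSum_iff_tendsto_nat_of_nonneg]
  · have : ∀ n, ∑ k ∈ Finset.range n,
        (2 / (((k + N : ℕ):ℝ) + 1) - 2 / (((k + 1 + N : ℕ):ℝ) + 1))
        = 2 / ((N:ℝ) + 1) - 2 / (((n + N : ℕ):ℝ) + 1) := by
      intro n
      rw [Finset.sum_range_sub' (fun k : ℕ => 2 / (((k + N : ℕ):ℝ) + 1)) n]
      simp
    simp_rw [this]
    simpa using h0.const_sub (2 / ((N:ℝ) + 1))
  · intro k
    rw [sub_nonneg]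
    apply div_le_div_of_nonneg_left (by norm_num) (by positivity)
    push_cast; linarith

lemma log_sum_asymp (R : ℝ → ℝ) (c : ℝ) (hR : ∀ x, 0 < x → |R x| ≤ 1 / x)
    (hc : Tendsto R (𝓝[>] 0) (𝓝 c)) :
    (fun t : ℝ => (∑' k : ℕ, R ((k + 1) * t) / (k + 1)) + c * log t)
      =o[𝓝[>] (0:ℝ)] (fun t => |log t|) := by
  rw [isLittleO_iff]
  intro ε hε
  rw [Metric.tendsto_nhdsWithin_nhds] at hc
  obtain ⟨δ₀, hδ₀, hδR⟩ := hc (ε / 2) (by linarith)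
  obtain ⟨δ, hδ, hδ1, hδδ⟩ : ∃ δ : ℝ, 0 < δ ∧ δ ≤ 1 ∧ δ < δ₀ :=
    ⟨min 1 (δ₀ / 2), by positivity, min_le_left _ _, lt_of_le_of_lt (min_le_right _ _) (by linarith)⟩
  have hRδ : ∀ x, 0 < x → x ≤ δ → |R x - c| ≤ ε / 2 := by
    intro x hx hxδ
    have := hδR (x := x) hx (by rw [Real.dist_eq, sub_zero, abs_of_pos hx]; linarith)
    rw [Real.dist_eq] at this
    exact this.le
  set A : ℝ := |c| * (1 + |log δ|) + ε / 2 + 2 / δ with hA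
  have hlogt : ∀ᶠ t : ℝ in 𝓝[>] 0, log t < -(2 * A / ε) :=
    Real.tendsto_log_nhdsGT_zero.eventually_lt_atBot _
  have hpos : ∀ᶠ t : ℝ in 𝓝[>] 0, 0 < t := eventually_mem_nhdsWithin
  have hsmall : ∀ᶠ t : ℝ in 𝓝[>] 0, t < δ :=
    (tendsto_nhdsWithin_of_tendsto_nhds tendsto_id).eventually_lt_const hδ
  filter_upwards [hlogt, hpos, hsmall] with t hl ht htδ
  have hAnn : 0 ≤ A := by rw [hA]; positivity
  have hlneg : log t < 0 := Real.log_neg ht (by linarith)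
  rw [Real.norm_eq_abs, Real.norm_eq_abs, abs_abs, abs_of_neg hlneg]
  set N : ℕ := ⌊δ / t⌋₊ with hN
  have hNle : (N:ℝ) ≤ δ / t := Nat.floor_le (by positivity)
  have hNlt : δ / t < (N:ℝ) + 1 := Nat.lt_floor_add_one _
  have hN1 : 1 ≤ N := by
    rw [hN]; apply Nat.le_floor
    rw [Nat.cast_one, le_div_iff₀ ht]; linarith
  have hN0 : (0:ℝ) < N := by exact_mod_cast hN1
  -- harmonic
  set H : ℝ := ∑ k ∈ Finset.range N, 1 / ((k:ℝ) + 1) with hH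
  have hharm : ((harmonic N : ℚ) : ℝ) = H := by
    rw [hH, harmonic]; push_cast
    simp
  have H1 : H ≤ 1 - log t := by
    have h := harmonic_le_one_add_log N
    rw [hharm] at h
    have h2 : log N ≤ log (δ / t) := Real.log_le_log hN0 hNle
    rw [Real.log_div hδ.ne' ht.ne'] at h2
    have h3 : log δ ≤ 0 := Real.log_nonpos hδ.le hδ1
    linarith
  have H2 : -|log δ| - log t ≤ H := by
    have h := log_add_one_le_harmonic N
    rw [hharm] at h
    have h2 : log (δ / t) ≤ log ((N + 1 : ℕ):ℝ) :=
      Real.log_le_log (by positivity) (by push_cast; exact hNlt.le)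
    rw [Real.log_div hδ.ne' ht.ne'] at h2
    have h3 := neg_abs_le (log δ)
    linarith
  have H3 : |H + log t| ≤ 1 + |log δ| := by
    rw [abs_le]; constructor <;> linarith [abs_nonneg (log δ)]
  -- termwise tail bound
  have hterm : ∀ k : ℕ, ‖R (((k + N : ℕ) + 1) * t) / (((k + N : ℕ):ℝ) + 1)‖ ≤
      (1 / t) * (2 / (((k + N : ℕ):ℝ) + 1) - 2 / (((k + 1 + N : ℕ):ℝ) + 1)) := by
    intro k
    have hm : (0:ℝ) ≤ ((k + N : ℕ):ℝ) := Nat.cast_nonneg _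
    have e0 : ((k + 1 + N : ℕ):ℝ) = ((k + N : ℕ):ℝ) + 1 := by push_cast; ring
    rw [e0]
    set m : ℝ := ((k + N : ℕ):ℝ) with hmdef
    rw [norm_div, Real.norm_eq_abs, Real.norm_eq_abs, abs_of_pos (show 0 < m + 1 by linarith)]
    have h1 := hR ((m + 1) * t) (by positivity)
    calc |R ((m + 1) * t)| / (m + 1) ≤ (1 / ((m + 1) * t)) / (m + 1) := by gcongr
      _ = (1 / t) * (1 / ((m + 1) * (m + 1))) := by field_simp
      _ ≤ (1 / t) * (2 / (m + 1) - 2 / (m + 1 + 1)) := by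
          have e : 2 / (m + 1) - 2 / (m + 1 + 1) = 2 / ((m + 1) * (m + 1 + 1)) := by
            field_simp; ring
          rw [e]
          apply mul_le_mul_of_nonneg_left _ (by positivity)
          rw [div_le_div_iff₀ (by positivity) (by positivity)]
          nlinarith
  have hmaj := (tail_hasSum N).mul_left (1 / t)
  have htail := tsum_of_norm_bounded hmaj hterm
  have hts : Summable (fun k : ℕ => R (((k + N : ℕ) + 1) * t) / (((k + N : ℕ):ℝ) + 1)) :=
    Summable.of_norm_bounded hmaj.summable hterm
  have hsum : Summable (fun k : ℕ => R (((k:ℕ) + 1) * t) / ((k:ℝ) + 1)) :=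
    (summable_nat_add_iff N).1 hts
  rw [← hsum.sum_add_tsum_nat_add N]
  rw [Real.norm_eq_abs] at htail
  have htail2 : (1 / t) * (2 / ((N:ℝ) + 1)) ≤ 2 / δ := by
    rw [div_lt_iff₀ ht] at hNlt
    rw [div_mul_div_comm, one_mul, div_le_div_iff₀ (by positivity) hδ]
    nlinarith
  have hhead : |∑ k ∈ Finset.range N, R (((k:ℕ) + 1) * t) / ((k:ℝ) + 1) - c * H| ≤ ε / 2 * H := by
    rw [hH, Finset.mul_sum, Finset.mul_sum, ← Finset.sum_sub_distrib]
    refine (Finset.abs_sum_le_sum_abs _ _).trans ?_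
    apply Finset.sum_le_sum
    intro k hk
    have hk' : (k:ℝ) + 1 ≤ N := by exact_mod_cast Finset.mem_range.1 hk
    have hk0 : (0:ℝ) < (k:ℝ) + 1 := by positivity
    have e : R (((k:ℕ) + 1) * t) / ((k:ℝ) + 1) - c * (1 / ((k:ℝ) + 1))
      = (R (((k:ℕ) + 1) * t) - c) * (1 / ((k:ℝ) + 1)) := by ring
    rw [e, abs_mul, abs_of_pos (show 0 < 1 / ((k:ℝ) + 1) by positivity)]
    apply mul_le_mul_of_nonneg_right _ (by positivity)
    apply hRδ _ (by positivity)
    calc ((k:ℝ) + 1) * t ≤ (δ / t) * t := by gcongr; linarith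
      _ = δ := by field_simp
  set X := ∑ k ∈ Finset.range N, R (((k:ℕ) + 1) * t) / ((k:ℝ) + 1) with hX
  set Y := ∑' k : ℕ, R (((k + N : ℕ) + 1) * t) / (((k + N : ℕ):ℝ) + 1) with hY
  have hcH : |c * (H + log t)| ≤ |c| * (1 + |log δ|) := by
    rw [abs_mul]; gcongr
  have e : X + Y + c * log t = (X - c * H) + Y + c * (H + log t) := by ring
  rw [e]
  have t1 := abs_add_le ((X - c * H) + Y) (c * (H + log t))
  have t2 := abs_add_le (X - c * H) Y
  have hl2 : A ≤ ε / 2 * (-log t) := by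
    have : 2 * A / ε < - log t := by linarith
    rw [div_lt_iff₀ hε] at this
    linarith
  have hH' : ε / 2 * H ≤ ε / 2 * (1 - log t) := by gcongr
  rw [hA] at hl2
  linarith

theorem stmt5 (α : ℝ) (hα : 1 < α) (hirr : Irrational α) :
    (fun t : ℝ =>
        LBeatty α t - π ^ 2 / (6 * α * t) - (1 - α⁻¹) / 2 * Real.log t)
      =o[𝓝[>] (0 : ℝ)] (fun t => |Real.log t|) := by
  have hα0 : 0 < α := by linarith
  have h := log_sum_asymp (fun x => Gb α x - 1 / (α * x)) (-((1 - α⁻¹) / 2)) (by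
    intro x hx
    have hb := Gb_bounds α hα x hx
    have h1 : 0 < 1 / (α * x) := by positivity
    have h2 : 1 / (α * x) ≤ 1 / x := one_div_le_one_div_of_le hx (by nlinarith)
    rw [abs_le]; constructor <;> linarith [hb.1, hb.2]) (Gb_tendsto α hα hirr)
  refine h.congr' ?_ (EventuallyEq.refl _ _)
  filter_upwards [eventually_mem_nhdsWithin] with t ht
  have ht0 : 0 < t := ht
  have hz : HasSum (fun k : ℕ => 1 / (((k + 1 : ℕ):ℝ)) ^ 2) (π ^ 2 / 6) := by
    have := (hasSum_nat_add_iff' 1).2 hasSum_zeta_two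
    simpa using this
  have hs := (LBeatty_eq α hα t ht0).sub (hz.mul_left (1 / (α * t)))
  have e : ∑' k : ℕ, (Gb α ((k + 1) * t) - 1 / (α * ((k + 1) * t))) / ((k:ℝ) + 1)
      = LBeatty α t - 1 / (α * t) * (π ^ 2 / 6) := by
    rw [← hs.tsum_eq]
    apply tsum_congr
    intro k
    have : (0:ℝ) < (k:ℝ) + 1 := by positivity
    push_cast
    field_simp
  rw [e]
  have : π ^ 2 / (6 * α * t) = 1 / (α * t) * (π ^ 2 / 6) := by field_simp
  rw [this]; ring
end

section
/- Let α > 1 be an irrational real number and define L̂_α(t) = L_1(αt) + (t/2)·D(αt) for t > 0. Then as t → 0⁺, L̂_α(t) = π²/(6αt) + ((1 − α^{−1})/2)·log t + ((1 − α^{−1})/2)·log α + γ/(2α) − (1/2)·log(2π) + O(t^{1/2}). -/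
open Filter Topology Real Asymptotics

/-- `L₁(t) = -∑_{ℓ ≥ 1} log(1 - e^{-tℓ})`. -/
noncomputable def LOne (t : ℝ) : ℝ :=
  -∑' ℓ : ℕ, Real.log (1 - Real.exp (-t * (ℓ + 1)))

/-- `D(s) = ∑_{n ≥ 1} 1/(e^{ns} - 1)`. -/
noncomputable def DSum (s : ℝ) : ℝ :=
  ∑' n : ℕ, 1 / (Real.exp ((n + 1) * s) - 1)

/-- `L̂_α(t) = L₁(αt) + (t/2)·D(αt)`. -/
noncomputable def LHat (α : ℝ) (t : ℝ) : ℝ :=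
  LOne (α * t) + t / 2 * DSum (α * t)

namespace Stmt11Aux

/-- derivative of `psi` -/
noncomputable def pp (x : ℝ) : ℝ := 1 / (Real.exp x - 1) - 1 / x

noncomputable def psi (x : ℝ) : ℝ := Real.log (1 - Real.exp (-x)) - Real.log x

noncomputable def GG (x : ℝ) : ℝ := ∑' n : ℕ, Real.exp (-x * (n + 1)) / ((n : ℝ) + 1) ^ 2

noncomputable def Psi (x : ℝ) : ℝ := GG x - x * Real.log x + x - π ^ 2 / 6

lemma exp_sub_pos {x : ℝ} (hx : 0 < x) : 0 < Real.exp x - 1 := by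
  have := Real.add_one_lt_exp hx.ne'
  linarith

lemma one_sub_pos {x : ℝ} (hx : 0 < x) : 0 < 1 - Real.exp (-x) := by
  have : Real.exp (-x) < 1 := Real.exp_lt_one_iff.mpr (by linarith)
  linarith

lemma pp_nonpos {x : ℝ} (hx : 0 < x) : pp x ≤ 0 := by
  unfold pp
  have := Real.add_one_lt_exp hx.ne'
  have := one_div_le_one_div_of_le hx (show x ≤ Real.exp x - 1 by linarith)
  linarith

lemma inv_eq {x : ℝ} (hx : 0 < x) : 1 / (Real.exp x - 1) + 1 = 1 / (1 - Real.exp (-x)) := by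
  have h1 := exp_sub_pos hx
  have h2 := one_sub_pos hx
  have h3 := Real.exp_pos x
  rw [Real.exp_neg] at *
  have : 1 - (Real.exp x)⁻¹ = (Real.exp x - 1) / Real.exp x := by field_simp
  rw [this]
  field_simp
  ring

lemma neg_one_le_pp {x : ℝ} (hx : 0 < x) : -1 ≤ pp x := by
  unfold pp
  have h := inv_eq hx
  have h2 := one_sub_pos hx
  have := Real.add_one_le_exp (-x)
  have := one_div_le_one_div_of_le h2 (show 1 - Real.exp (-x) ≤ x by linarith)
  linarith

lemma pp_hasDeriv {x : ℝ} (hx : 0 < x) :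
    HasDerivAt pp (-Real.exp x / (Real.exp x - 1) ^ 2 + 1 / x ^ 2) x := by
  have h1 := exp_sub_pos hx
  have := (((Real.hasDerivAt_exp x).sub_const 1).inv h1.ne').sub (hasDerivAt_inv hx.ne')
  refine (this.congr_deriv ?_).congr_of_eventuallyEq ?_
  · simp [div_eq_mul_inv]
  · exact Filter.Eventually.of_forall fun y => by simp [pp]

lemma pp_mono : MonotoneOn pp (Set.Ioi 0) := by
  apply monotoneOn_of_deriv_nonneg (convex_Ioi 0)
  · exact fun x hx => (pp_hasDeriv hx).continuousAt.continuousWithinAt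
  · intro x hx
    rw [interior_Ioi] at hx
    exact (pp_hasDeriv hx).differentiableAt.differentiableWithinAt
  · intro x hx
    rw [interior_Ioi] at hx
    have hx : 0 < x := hx
    rw [(pp_hasDeriv hx).deriv]
    have h1 := exp_sub_pos hx
    have h := Real.self_le_sinh_iff.2 (show 0 ≤ x / 2 by linarith)
    rw [Real.sinh_eq] at h
    set u := Real.exp (x / 2) with hu
    have hup : 0 < u := Real.exp_pos _
    have hux : Real.exp x = u ^ 2 := by rw [hu, ← Real.exp_nat_mul]; congr 1; push_cast; ring
    have hum : Real.exp (-(x / 2)) = u⁻¹ := Real.exp_neg _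
    rw [hum] at h
    have h2 : x * u ≤ u ^ 2 - 1 := by
      have : x * u ≤ (u - u⁻¹) * u := by gcongr; linarith
      have h3 : (u - u⁻¹) * u = u ^ 2 - 1 := by field_simp
      linarith
    rw [hux] at h1 ⊢
    have h4 : u ^ 2 / (u ^ 2 - 1) ^ 2 ≤ 1 / x ^ 2 := by
      rw [div_le_div_iff₀ (pow_pos h1 2) (by positivity)]
      have : (x * u) ^ 2 ≤ (u ^ 2 - 1) ^ 2 := by gcongr
      nlinarith
    rw [neg_div]
    linarith

lemma psi_hasDeriv {x : ℝ} (hx : 0 < x) : HasDerivAt psi (pp x) x := by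
  have h2 := one_sub_pos hx
  have e : HasDerivAt (fun y : ℝ => 1 - Real.exp (-y)) (Real.exp (-x)) x := by
    have := ((hasDerivAt_neg x).exp).const_sub 1
    simpa using this
  have := (e.log h2.ne').sub (Real.hasDerivAt_log hx.ne')
  refine this.congr_deriv ?_
  unfold pp
  have h := inv_eq hx
  have h5 : Real.exp (-x) / (1 - Real.exp (-x)) = 1 / (1 - Real.exp (-x)) - 1 := by field_simp; ring
  rw [h5, ← h]
  simp

lemma psi_nonpos {x : ℝ} (hx : 0 < x) : psi x ≤ 0 := by
  unfold psi
  have := Real.add_one_le_exp (-x)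
  have := Real.log_le_log (one_sub_pos hx) (show 1 - Real.exp (-x) ≤ x by linarith)
  linarith

lemma neg_le_psi {x : ℝ} (hx : 0 < x) : -x ≤ psi x := by
  unfold psi
  have h := Real.add_one_le_exp x
  have h0 := Real.exp_pos (-x)
  have h3 : Real.exp (-x) * Real.exp x = 1 := by rw [← Real.exp_add]; simp
  have := Real.log_le_log (by positivity) (show x * Real.exp (-x) ≤ 1 - Real.exp (-x) by nlinarith)
  rw [Real.log_mul hx.ne' h0.ne', Real.log_exp] at this
  linarith

lemma summable_sq : HasSum (fun n : ℕ => 1 / ((n : ℝ) + 1) ^ 2) (π ^ 2 / 6) := by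
  have := (hasSum_nat_add_iff' 1).2 hasSum_zeta_two
  simpa using this

lemma exp_sum {x : ℝ} (hx : 0 < x) : Summable (fun n : ℕ => Real.exp (-x * (n + 1))) := by
  have h := (summable_geometric_of_lt_one (Real.exp_pos (-x)).le
    (Real.exp_lt_one_iff.mpr (by linarith : -x < 0))).mul_left (Real.exp (-x))
  refine h.congr fun n => ?_
  rw [← Real.exp_nat_mul, ← Real.exp_add]
  congr 1; ring

lemma GG_term_le {x : ℝ} (hx : 0 ≤ x) (n : ℕ) :
    Real.exp (-x * (n + 1)) / ((n : ℝ) + 1) ^ 2 ≤ Real.exp (-x) * (1 / ((n : ℝ) + 1) ^ 2) := by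
  rw [mul_one_div]
  gcongr
  have : 0 ≤ x * n := by positivity
  nlinarith

lemma GG_summable {x : ℝ} (hx : 0 ≤ x) :
    Summable (fun n : ℕ => Real.exp (-x * (n + 1)) / ((n : ℝ) + 1) ^ 2) :=
  Summable.of_nonneg_of_le (fun n => by positivity) (GG_term_le hx)
    (summable_sq.summable.mul_left _)

lemma GG_nonneg (x : ℝ) : 0 ≤ GG x := tsum_nonneg fun n => by positivity

lemma GG_le {x : ℝ} (hx : 0 ≤ x) : GG x ≤ Real.exp (-x) * (π ^ 2 / 6) := by
  rw [← (summable_sq.mul_left (Real.exp (-x))).tsum_eq]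
  exact (GG_summable hx).tsum_le_tsum (GG_term_le hx) (summable_sq.summable.mul_left _)

lemma GG_cont : ContinuousOn GG (Set.Ici 0) := by
  apply continuousOn_tsum (u := fun n : ℕ => 1 / ((n : ℝ) + 1) ^ 2)
  · intro n; fun_prop
  · exact summable_sq.summable
  · intro n x hx
    have hx : 0 ≤ x := hx
    rw [Real.norm_of_nonneg (by positivity)]
    gcongr
    rw [Real.exp_le_one_iff]
    have : 0 ≤ x * (n + 1) := by positivity
    linarith

lemma GG_zero : GG 0 = π ^ 2 / 6 := by
  unfold GG
  rw [← summable_sq.tsum_eq]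
  simp

lemma GG_hasDeriv {x : ℝ} (hx : 0 < x) : HasDerivAt GG (Real.log (1 - Real.exp (-x))) x := by
  have key := hasDerivAt_tsum_of_isPreconnected (𝕜 := ℝ) (F := ℝ)
    (u := fun n : ℕ => Real.exp (-(x / 2) * (n + 1)))
    (g := fun (n : ℕ) (y : ℝ) => Real.exp (-y * (n + 1)) / ((n : ℝ) + 1) ^ 2)
    (g' := fun (n : ℕ) (y : ℝ) => -(Real.exp (-y * (n + 1)) / ((n : ℝ) + 1)))
    (t := Set.Ioi (x / 2)) (y₀ := x) (y := x) (exp_sum (by linarith)) isOpen_Ioi isPreconnected_Ioi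
    ?_ ?_ (by simp; linarith) (GG_summable hx.le) (by simp; linarith)
  · refine key.congr_deriv ?_
    have h := Real.hasSum_pow_div_log_of_abs_lt_one (x := Real.exp (-x))
      (by rw [abs_of_pos (Real.exp_pos _)]; exact Real.exp_lt_one_iff.mpr (by linarith))
    have h2 := h.neg.tsum_eq
    rw [neg_neg] at h2
    rw [← h2]
    refine tsum_congr fun n => ?_
    rw [← Real.exp_nat_mul]
    push_cast
    rw [mul_comm]
  · intro n y hy
    have h1 : HasDerivAt (fun y : ℝ => -y * ((n : ℝ) + 1)) (-1 * ((n : ℝ) + 1)) y :=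
      (hasDerivAt_neg y).mul_const _
    refine (h1.exp.div_const (((n : ℝ) + 1) ^ 2)).congr_deriv ?_
    have : (n : ℝ) + 1 ≠ 0 := by positivity
    field_simp
  · intro n y hy
    have hy : x / 2 < y := hy
    rw [norm_neg, Real.norm_of_nonneg (by positivity)]
    have h1 : Real.exp (-y * (n + 1)) / ((n : ℝ) + 1) ≤ Real.exp (-y * (n + 1)) :=
      div_le_self (Real.exp_pos _).le (by linarith [(Nat.cast_nonneg n : (0:ℝ) ≤ n)])
    refine h1.trans ?_
    gcongr

lemma Psi_hasDeriv {x : ℝ} (hx : 0 < x) : HasDerivAt Psi (psi x) x := by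
  have := (((GG_hasDeriv hx).sub (Real.hasDerivAt_mul_log hx.ne')).add (hasDerivAt_id x)).sub_const
    (π ^ 2 / 6)
  refine this.congr_deriv ?_
  unfold psi
  ring

lemma Psi_cont : ContinuousOn Psi (Set.Ici 0) :=
  ((GG_cont.sub Real.continuous_mul_log.continuousOn).add continuousOn_id).sub continuousOn_const

lemma Psi_zero : Psi 0 = 0 := by simp [Psi, GG_zero]

lemma Psi_bound {x : ℝ} (hx : 0 < x) : -x ≤ Psi x / x ∧ Psi x / x ≤ 0 := by
  obtain ⟨c, hc, h⟩ := exists_hasDerivAt_eq_slope Psi psi hx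
    (Psi_cont.mono Set.Icc_subset_Ici_self) (fun y hy => Psi_hasDeriv hy.1)
  rw [Psi_zero, sub_zero, sub_zero] at h
  rw [← h]
  exact ⟨by linarith [neg_le_psi hc.1, hc.2], psi_nonpos hc.1⟩

lemma slope_psi {a b : ℝ} (ha : 0 < a) (hab : a < b) :
    (b - a) * pp a ≤ psi b - psi a ∧ psi b - psi a ≤ (b - a) * pp b := by
  obtain ⟨c, hc, h⟩ := exists_hasDerivAt_eq_slope psi pp hab
    (fun y hy => (psi_hasDeriv (ha.trans_le hy.1)).continuousAt.continuousWithinAt)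
    (fun y hy => psi_hasDeriv (ha.trans hy.1))
  have hba : 0 < b - a := by linarith
  have h2 : psi b - psi a = (b - a) * pp c := by rw [h]; field_simp
  have hc0 : 0 < c := ha.trans hc.1
  rw [h2]
  exact ⟨mul_le_mul_of_nonneg_left (pp_mono ha hc0 hc.1.le) hba.le,
    mul_le_mul_of_nonneg_left (pp_mono hc0 (ha.trans hab) hc.2.le) hba.le⟩

lemma trap {a b : ℝ} (ha : 0 < a) (hab : a < b) :
    0 ≤ (b - a) * (psi a + psi b) / 2 - (Psi b - Psi a) ∧
    (b - a) * (psi a + psi b) / 2 - (Psi b - Psi a) ≤ (b - a) ^ 2 / 2 * (pp b - pp a) := by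
  have hd : ∀ x, 0 < x → HasDerivAt (fun x => (x - a) * (psi a + psi x) / 2 - (Psi x - Psi a))
      ((1 * (psi a + psi x) + (x - a) * pp x) / 2 - psi x) x := fun x hx =>
    ((((hasDerivAt_id x).sub_const a).mul ((psi_hasDeriv hx).const_add (psi a))).div_const 2).sub
      ((Psi_hasDeriv hx).sub_const (Psi a))
  obtain ⟨c, hc, h⟩ := exists_hasDerivAt_eq_slope _ _ hab
    (fun y hy => (hd y (ha.trans_le hy.1)).continuousAt.continuousWithinAt)
    (fun y hy => hd y (ha.trans hy.1))
  have hba : 0 < b - a := by linarith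
  rw [eq_div_iff hba.ne'] at h
  simp only [sub_self, zero_mul, zero_div, sub_zero] at h
  rw [← h]
  have hc0 : 0 < c := ha.trans hc.1
  obtain ⟨s1, s2⟩ := slope_psi ha hc.1
  have hca : 0 < c - a := by linarith [hc.1]
  have m1 : pp c ≤ pp b := pp_mono hc0 (ha.trans hab) hc.2.le
  have m0 : pp a ≤ pp c := pp_mono ha hc0 hc.1.le
  refine ⟨mul_nonneg (by linarith) hba.le, ?_⟩
  have e1 : (c - a) * (pp c - pp a) ≤ (b - a) * (pp b - pp a) :=
    mul_le_mul (by linarith [hc.2]) (by linarith) (by linarith) hba.le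
  calc _ ≤ ((b - a) * (pp b - pp a) / 2) * (b - a) :=
        mul_le_mul_of_nonneg_right (by linarith) hba.le
    _ = _ := by ring

lemma sumB {s : ℝ} (hs : 0 < s) (N : ℕ) :
    s * (pp s - pp ((N + 1) * s)) ≤
      ∑ k ∈ Finset.range N, s * pp ((k + 1) * s) - (psi ((N + 1) * s) - psi s) ∧
    ∑ k ∈ Finset.range N, s * pp ((k + 1) * s) - (psi ((N + 1) * s) - psi s) ≤ 0 := by
  induction N with
  | zero => simp
  | succ N ih =>
    rw [Finset.sum_range_succ]
    push_cast
    obtain ⟨h1, h2⟩ := slope_psi (a := (N + 1) * s) (b := (N + 1 + 1) * s) (by positivity)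
      (by nlinarith)
    have e : ((N : ℝ) + 1 + 1) * s - (N + 1) * s = s := by ring
    rw [e] at h1 h2
    constructor <;> nlinarith [ih.1, ih.2]

lemma sumA {s : ℝ} (hs : 0 < s) (N : ℕ) :
    0 ≤ ∑ k ∈ Finset.range (N + 1), psi ((k + 1) * s) - psi s / 2 - psi ((N + 1) * s) / 2
      - (Psi ((N + 1) * s) - Psi s) / s ∧
    ∑ k ∈ Finset.range (N + 1), psi ((k + 1) * s) - psi s / 2 - psi ((N + 1) * s) / 2
      - (Psi ((N + 1) * s) - Psi s) / s ≤ s / 2 * (pp ((N + 1) * s) - pp s) := by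
  induction N with
  | zero => 
    have : psi s - psi s / 2 - psi s / 2 = 0 := by ring
    simp [this]
  | succ N ih =>
    rw [Finset.sum_range_succ]
    push_cast
    obtain ⟨h1, h2⟩ := trap (a := (N + 1) * s) (b := (N + 1 + 1) * s) (by positivity)
      (by nlinarith)
    have e : ((N : ℝ) + 1 + 1) * s - (N + 1) * s = s := by ring
    rw [e] at h1 h2
    set A := psi ((N + 1) * s)
    set B := psi ((N + 1 + 1) * s)
    set C := Psi ((N + 1) * s)
    set D := Psi ((N + 1 + 1) * s)
    have e2 : s * (A + B) / 2 - (D - C) = s * ((A + B) / 2 - (D - C) / s) := by field_simp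
    rw [e2] at h1 h2
    have h1' := nonneg_of_mul_nonneg_right h1 hs
    have h2' : (A + B) / 2 - (D - C) / s ≤ s / 2 * (pp ((N + 1 + 1) * s) - pp ((N + 1) * s)) := by
      refine le_of_mul_le_mul_left ?_ hs
      refine h2.trans (le_of_eq ?_)
      ring
    have e3 : (D - Psi s) / s = (D - C) / s + (C - Psi s) / s := by ring
    rw [e3]
    constructor <;> linarith [ih.1, ih.2]

lemma tendsto_lin {s : ℝ} (hs : 0 < s) :
    Tendsto (fun N : ℕ => ((N : ℝ) + 1) * s) atTop atTop :=
  Tendsto.atTop_mul_const hs (tendsto_atTop_add_const_right _ _ tendsto_natCast_atTop_atTop)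

lemma tendsto_log : Tendsto (fun x : ℝ => Real.log (1 - Real.exp (-x))) atTop (𝓝 0) := by
  have h : Tendsto (fun x : ℝ => 1 - Real.exp (-x)) atTop (𝓝 (1 - 0)) :=
    tendsto_const_nhds.sub (Real.tendsto_exp_neg_atTop_nhds_zero)
  rw [sub_zero] at h
  simpa using h.log one_ne_zero

lemma tendsto_GG : Tendsto GG atTop (𝓝 0) := by
  have h := Real.tendsto_exp_neg_atTop_nhds_zero.mul_const (π ^ 2 / 6)
  rw [zero_mul] at h
  refine tendsto_of_tendsto_of_tendsto_of_le_of_le' tendsto_const_nhds h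
    (Eventually.of_forall GG_nonneg) ?_
  filter_upwards [eventually_ge_atTop 0] with x hx using GG_le hx

lemma summable_L {s : ℝ} (hs : 0 < s) :
    Summable (fun l : ℕ => Real.log (1 - Real.exp (-s * (l + 1)))) := by
  have := Real.summable_log_one_add_of_summable (exp_sum hs).neg
  simpa [sub_eq_add_neg] using this

lemma summable_D {s : ℝ} (hs : 0 < s) :
    Summable (fun n : ℕ => 1 / (Real.exp ((n + 1) * s) - 1)) := by
  refine Summable.of_nonneg_of_le (fun n => ?_) (fun n => ?_)
    ((exp_sum hs).mul_left (1 / (1 - Real.exp (-s))))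
  · have := exp_sub_pos (x := (n + 1) * s) (by positivity)
    positivity
  · have h1 := exp_sub_pos (x := (n + 1) * s) (by positivity)
    have h2 := one_sub_pos hs
    have h3 : Real.exp (-s * (n + 1)) = (Real.exp ((n + 1) * s))⁻¹ := by
      rw [← Real.exp_neg]; congr 1; ring
    have h4 : Real.exp (-s) * Real.exp ((n + 1) * s) ≥ 1 := by
      rw [← Real.exp_add]
      apply Real.one_le_exp
      have : 0 ≤ n * s := by positivity
      linarith
    rw [h3, ← one_div, one_div_mul_one_div]
    refine one_div_le_one_div_of_le (by positivity) ?_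
    linarith

lemma boundB {s : ℝ} (hs : 0 < s) :
    |s * DSum s - (Real.eulerMascheroniConstant - Real.log s)| ≤ 2 * s := by
  have hD := ((summable_D hs).hasSum.tendsto_sum_nat).const_mul s
  have hg := Real.tendsto_eulerMascheroniSeq
  have hf := tendsto_log.comp (tendsto_lin hs)
  have hlim := ((hD.sub hg).sub hf).add_const (Real.log s + psi s)
  have key : ∀ N : ℕ, s * ∑ k ∈ Finset.range N, 1 / (Real.exp ((k + 1) * s) - 1)
      - Real.eulerMascheroniSeq N - Real.log (1 - Real.exp (-((N + 1) * s)))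
      + (Real.log s + psi s) =
      ∑ k ∈ Finset.range N, s * pp ((k + 1) * s) - (psi ((N + 1) * s) - psi s) := by
    intro N
    have hH : ((harmonic N : ℚ) : ℝ) = ∑ k ∈ Finset.range N, s * (1 / ((k + 1) * s)) := by
      rw [harmonic]
      push_cast
      refine Finset.sum_congr rfl fun k _ => ?_
      have : (k : ℝ) + 1 ≠ 0 := by positivity
      field_simp
    have h1 : ∑ k ∈ Finset.range N, s * pp ((k + 1) * s) =
        s * ∑ k ∈ Finset.range N, 1 / (Real.exp ((k + 1) * s) - 1) - (harmonic N : ℚ) := by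
      rw [hH, Finset.mul_sum, ← Finset.sum_sub_distrib]
      refine Finset.sum_congr rfl fun k _ => ?_
      unfold pp; ring
    rw [h1, Real.eulerMascheroniSeq]
    have h2 : psi ((N + 1) * s) = Real.log (1 - Real.exp (-((N + 1) * s)))
        - (Real.log (N + 1) + Real.log s) := by
      rw [psi, Real.log_mul (by positivity) hs.ne']
    rw [h2]
    ring
  have u := le_of_tendsto hlim (b := 0) (Eventually.of_forall fun N => by
    have := (sumB hs N).2
    rw [← key N] at this
    exact this)
  have l := ge_of_tendsto hlim (b := -s) (Eventually.of_forall fun N => by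
    have := (sumB hs N).1
    rw [key N |>.symm] at this
    have h1 := neg_one_le_pp hs
    have h2 := pp_nonpos (x := ((N : ℝ) + 1) * s) (by positivity)
    refine le_trans ?_ this
    nlinarith)
  have p1 := psi_nonpos hs
  have p2 := neg_le_psi hs
  have hDs : DSum s = ∑' n : ℕ, 1 / (Real.exp ((n + 1) * s) - 1) := rfl
  rw [← hDs] at u l
  rw [abs_le]
  constructor <;> linarith

lemma boundA {s : ℝ} (hs : 0 < s) :
    |LOne s - (π ^ 2 / (6 * s) + 1 / 2 * Real.log s - 1 / 2 * Real.log (2 * π))| ≤ 2 * s := by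
  have hL := (summable_L hs).hasSum.tendsto_sum_nat.comp (tendsto_add_atTop_nat 1)
  have hst := (Stirling.tendsto_stirlingSeq_sqrt_pi.log (by positivity)).comp
    (tendsto_add_atTop_nat 1)
  have hf := (tendsto_log.comp (tendsto_lin hs)).div_const 2
  have hG := (tendsto_GG.comp (tendsto_lin hs)).div_const s
  have hlim := ((((hL.sub hst).sub hf).sub hG)).add_const
    (-(1 / 2) * Real.log 2 + 1 / 2 * Real.log s + π ^ 2 / (6 * s) - psi s / 2 + Psi s / s)
  have key : ∀ N : ℕ, ∑ k ∈ Finset.range (N + 1), Real.log (1 - Real.exp (-s * (k + 1)))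
      - Real.log (Stirling.stirlingSeq (N + 1))
      - Real.log (1 - Real.exp (-((N + 1) * s))) / 2 - GG ((N + 1) * s) / s
      + (-(1 / 2) * Real.log 2 + 1 / 2 * Real.log s + π ^ 2 / (6 * s) - psi s / 2 + Psi s / s) =
      ∑ k ∈ Finset.range (N + 1), psi ((k + 1) * s) - psi s / 2 - psi ((N + 1) * s) / 2
      - (Psi ((N + 1) * s) - Psi s) / s := by
    intro N
    have hfac : ∀ M : ℕ, ∑ k ∈ Finset.range M, psi ((k + 1) * s) =
        ∑ k ∈ Finset.range M, Real.log (1 - Real.exp (-s * (k + 1)))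
        - M * Real.log s - Real.log (M.factorial : ℝ) := by
      intro M
      induction M with
      | zero => simp
      | succ M ih =>
        rw [Finset.sum_range_succ, Finset.sum_range_succ, ih, Nat.factorial_succ]
        push_cast
        have hM : (M.factorial : ℝ) ≠ 0 := by positivity
        rw [Real.log_mul (by positivity) hM, psi, Real.log_mul (by positivity) hs.ne']
        have : -(((M : ℝ) + 1) * s) = -s * (M + 1) := by ring
        rw [this]
        ring
    have hN : (N : ℝ) + 1 ≠ 0 := by positivity
    rw [hfac, Stirling.log_stirlingSeq_formula]
    push_cast
    rw [Real.log_div hN (Real.exp_pos 1).ne', Real.log_exp, Real.log_mul two_ne_zero hN]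
    have h2 : psi ((N + 1) * s) = Real.log (1 - Real.exp (-((N + 1) * s)))
        - (Real.log (N + 1) + Real.log s) := by
      rw [psi, Real.log_mul (by positivity) hs.ne']
    have h3 : Psi ((N + 1) * s) = GG ((N + 1) * s) - (N + 1) * s * (Real.log (N + 1) + Real.log s)
        + (N + 1) * s - π ^ 2 / 6 := by
      rw [Psi, Real.log_mul (by positivity) hs.ne']
    rw [h2, h3]
    field_simp
    ring
  have l := ge_of_tendsto hlim (b := 0) (Eventually.of_forall fun N => by
    have := (sumA hs N).1
    rw [← key N] at this
    exact this)
  have u := le_of_tendsto hlim (b := s / 2) (Eventually.of_forall fun N => by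
    have := (sumA hs N).2
    rw [← key N] at this
    have h1 := neg_one_le_pp hs
    have h2 := pp_nonpos (x := ((N : ℝ) + 1) * s) (by positivity)
    refine le_trans this ?_
    nlinarith)
  have p1 := psi_nonpos hs
  have p2 := neg_le_psi hs
  obtain ⟨p3, p4⟩ := Psi_bound hs
  have hDs : LOne s = -∑' l : ℕ, Real.log (1 - Real.exp (-s * (l + 1))) := rfl
  rw [show ∑' l : ℕ, Real.log (1 - Real.exp (-s * (l + 1))) = - LOne s by rw [hDs, neg_neg],
    Real.log_sqrt Real.pi_pos.le] at u l
  rw [zero_div, zero_div] at u l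
  rw [Real.log_mul two_ne_zero Real.pi_ne_zero, abs_le]
  constructor <;> linarith

end Stmt11Aux

open Stmt11Aux in
theorem stmt11 (α : ℝ) (hα : 1 < α) (hirr : Irrational α) :
    (fun t : ℝ =>
        LHat α t - (π ^ 2 / (6 * α * t) + (1 - α⁻¹) / 2 * Real.log t
          + (1 - α⁻¹) / 2 * Real.log α + Real.eulerMascheroniConstant / (2 * α)
          - (1 / 2) * Real.log (2 * π)))
      =O[𝓝[>] (0 : ℝ)] (fun t => Real.sqrt t) := by
  have hα0 : 0 < α := by linarith
  refine IsBigO.of_bound (2 * α + 1) ?_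
  filter_upwards [Ioo_mem_nhdsGT (zero_lt_one' ℝ)] with t ht
  obtain ⟨ht0, ht1⟩ := ht
  have hs : 0 < α * t := by positivity
  have hA := boundA hs
  have hB := boundB hs
  rw [Real.norm_eq_abs, Real.norm_of_nonneg (Real.sqrt_nonneg t)]
  have hsq : t ≤ Real.sqrt t := Real.le_sqrt_of_sq_le (by nlinarith)
  have e : LHat α t - (π ^ 2 / (6 * α * t) + (1 - α⁻¹) / 2 * Real.log t
          + (1 - α⁻¹) / 2 * Real.log α + Real.eulerMascheroniConstant / (2 * α)
          - (1 / 2) * Real.log (2 * π)) =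
      (LOne (α * t) - (π ^ 2 / (6 * (α * t)) + 1 / 2 * Real.log (α * t)
        - 1 / 2 * Real.log (2 * π))) + 1 / (2 * α) *
      (α * t * DSum (α * t) - (Real.eulerMascheroniConstant - Real.log (α * t))) := by
    rw [LHat, Real.log_mul hα0.ne' ht0.ne']
    field_simp
    ring
  rw [e]
  refine (abs_add_le _ _).trans ?_
  rw [abs_mul, abs_of_pos (by positivity : 0 < 1 / (2 * α))]
  have h2 : 1 / (2 * α) * |α * t * DSum (α * t) -
      (Real.eulerMascheroniConstant - Real.log (α * t))| ≤ t := by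
    calc _ ≤ 1 / (2 * α) * (2 * (α * t)) := by gcongr
      _ = t := by field_simp
  calc _ ≤ 2 * (α * t) + t := add_le_add hA h2
    _ = (2 * α + 1) * t := by ring
    _ ≤ _ := by gcongr
end

section
/- Let α > 1 be an irrational real number and define L̂_α(t) = L_1(αt) + (t/2)·D(αt) for t > 0. Then as t → 0⁺, the derivative satisfies L̂_α'(t) = −π²/(6αt²) + (1 − α^{−1})/(2t) + O(t^{−1/2}). -/
open Filter Topology Real Asymptotics

/-- `b u = 1/(e^u - 1)`. -/
noncomputable def bF (u : ℝ) : ℝ := 1 / (Real.exp u - 1)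

lemma exp_sub_pos {u : ℝ} (hu : 0 < u) : 0 < Real.exp u - 1 := by
  have := Real.add_one_lt_exp hu.ne'
  linarith

lemma bF_pos {u : ℝ} (hu : 0 < u) : 0 < bF u := one_div_pos.2 (exp_sub_pos hu)

lemma bF_deriv {u : ℝ} (hu : 0 < u) : HasDerivAt bF (-(bF u * (bF u + 1))) u := by
  have h := exp_sub_pos hu
  have h1 : HasDerivAt (fun u => Real.exp u - 1) (Real.exp u) u :=
    (Real.hasDerivAt_exp u).sub_const 1
  have h2 := h1.inv h.ne'
  have h3 : bF = (fun u => Real.exp u - 1)⁻¹ := by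
    funext x; simp [bF]
  rw [h3]
  refine HasDerivAt.congr_deriv (h2) ?_
  simp only [Pi.inv_apply]
  field_simp
  ring

/-- `x e^{x/2} ≤ e^x - 1`. -/
lemma bF_le {x : ℝ} (hx : 0 < x) : x * bF x ≤ Real.exp (-x / 2) := by
  have h := exp_sub_pos hx
  have h1 : x / 2 ≤ Real.sinh (x / 2) := Real.self_le_sinh_iff.2 (by linarith)
  rw [Real.sinh_eq] at h1
  have e1 : Real.exp (-(x / 2)) = (Real.exp (x / 2))⁻¹ := Real.exp_neg _
  have e2 : Real.exp x = Real.exp (x / 2) * Real.exp (x / 2) := by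
    rw [← Real.exp_add]; congr 1; ring
  have e3 : Real.exp (-x / 2) = (Real.exp (x / 2))⁻¹ := by rw [← Real.exp_neg]; congr 1; ring
  have hp := Real.exp_pos (x / 2)
  rw [bF, e3, mul_one_div, div_le_iff₀ h]
  rw [e1] at h1
  have : (Real.exp (x / 2))⁻¹ * (Real.exp x - 1) = Real.exp (x / 2) - (Real.exp (x / 2))⁻¹ := by
    rw [e2]; field_simp
  rw [this]; linarith

noncomputable def psiF (u : ℝ) : ℝ := 1 / u - bF u
noncomputable def phiF (u : ℝ) : ℝ := bF u * (bF u + 1) - 1 / u ^ 2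
noncomputable def gF (u : ℝ) : ℝ := u * bF u
noncomputable def gamF (u : ℝ) : ℝ := bF u - u * (bF u * (bF u + 1))

lemma psiF_deriv {u : ℝ} (hu : 0 < u) : HasDerivAt psiF (phiF u) u := by
  have h1 := (hasDerivAt_inv hu.ne').sub (bF_deriv hu)
  have : psiF = (fun x : ℝ => x⁻¹) - bF := by funext x; simp [psiF]
  rw [this]
  refine HasDerivAt.congr_deriv (h1) ?_
  simp [phiF]; ring

lemma gF_deriv {u : ℝ} (hu : 0 < u) : HasDerivAt gF (gamF u) u := by
  have h1 := (hasDerivAt_id u).mul (bF_deriv hu)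
  have : gF = id * bF := by funext x; simp [gF]
  rw [this]
  refine HasDerivAt.congr_deriv (h1) ?_
  simp [gamF]; ring

lemma mono_nonneg {f f' : ℝ → ℝ} (hd : ∀ x, HasDerivAt f (f' x) x)
    (h0 : f 0 = 0) (hf' : ∀ x, 0 ≤ x → 0 ≤ f' x) : ∀ x, 0 ≤ x → 0 ≤ f x := by
  have hm : MonotoneOn f (Set.Ici 0) := by
    apply monotoneOn_of_deriv_nonneg (convex_Ici 0)
    · exact fun x _ => (hd x).continuousAt.continuousWithinAt
    · exact fun x _ => (hd x).differentiableAt.differentiableWithinAt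
    · intro x hx
      rw [(hd x).deriv]
      exact hf' x (interior_subset hx)
  intro x hx
  have := hm (Set.mem_Ici.2 le_rfl) (Set.mem_Ici.2 hx) hx
  linarith

lemma exp_ineq {u : ℝ} (hu : 0 ≤ u) : 0 ≤ Real.exp u * (u - 2) + u + 2 := by
  have A : ∀ x : ℝ, 0 ≤ x → 0 ≤ Real.exp x * (x - 1) + 1 := by
    apply mono_nonneg (f' := fun x => Real.exp x * x)
    · intro x
      refine HasDerivAt.congr_deriv (((Real.hasDerivAt_exp x).mul ((hasDerivAt_id x).sub_const 1)).add_const 1) ?_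
      simp; ring
    · simp
    · intro x hx; positivity
  have B : ∀ x : ℝ, 0 ≤ x → 0 ≤ Real.exp x * (x - 2) + x + 2 := by
    apply mono_nonneg (f' := fun x => Real.exp x * (x - 1) + 1) _ (by simp) A
    intro x
    refine HasDerivAt.congr_deriv ((((Real.hasDerivAt_exp x).mul ((hasDerivAt_id x).sub_const 2)).add
      (hasDerivAt_id x)).add_const 2) ?_
    simp; ring
  exact B u hu

lemma psiF_le {u : ℝ} (hu : 0 < u) : psiF u ≤ 1 / 2 := by
  have h := exp_sub_pos hu
  have := exp_ineq hu.le
  unfold psiF bF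
  rw [div_sub_div _ _ hu.ne' h.ne', div_le_div_iff₀ (by positivity) (by norm_num)]
  nlinarith

lemma psiF_ge {u : ℝ} (hu : 0 < u) : 1 / 2 - u / 4 ≤ psiF u := by
  have h := exp_sub_pos hu
  have h2 := Real.quadratic_le_exp_of_nonneg hu.le
  unfold psiF
  have : bF u ≤ 1 / (u + u ^ 2 / 2) := by
    unfold bF
    apply one_div_le_one_div_of_le (by positivity); linarith
  have h3 : 1 / (u + u ^ 2 / 2) ≤ 1 / u - 1 / 2 + u / 4 := by
    rw [div_le_iff₀ (by positivity)]
    have : (1 / u - 1 / 2 + u / 4) * (u + u ^ 2 / 2) = 1 + u ^ 3 / 8 := by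
      field_simp; ring
    rw [this]
    have := pow_pos hu 3
    linarith
  linarith

lemma phiF_eq {u : ℝ} (hu : 0 < u) :
    phiF u = (1 - 2 * psiF u) / u + psiF u ^ 2 - psiF u := by
  unfold phiF psiF
  field_simp; ring

lemma phiF_ge {u : ℝ} (hu : 0 < u) : -(1 / 4) ≤ phiF u := by
  rw [phiF_eq hu]
  have := psiF_le hu
  have : 0 ≤ (1 - 2 * psiF u) / u := div_nonneg (by linarith) hu.le
  nlinarith [sq_nonneg (psiF u - 1 / 2)]

lemma gamF_ge {u : ℝ} (hu : 0 < u) (hu1 : u ≤ 1) : -2 ≤ gamF u := by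
  have h1 := psiF_le hu
  have h2 := psiF_ge hu
  have : gamF u = -psiF u - (1 - 2 * psiF u) - u * (psiF u ^ 2 - psiF u) := by
    unfold gamF psiF; field_simp; ring
  rw [this]
  have : 0 ≤ u * (psiF u - psiF u ^ 2) := mul_nonneg hu.le (by nlinarith)
  linarith

lemma gamF_mono : MonotoneOn gamF (Set.Ioi 0) := by
  have hd : ∀ u : ℝ, 0 < u →
      HasDerivAt gamF (bF u * (bF u + 1) * (u * (2 * bF u + 1) - 2)) u := by
    intro u hu
    have hb := bF_deriv hu
    refine HasDerivAt.congr_deriv (hb.sub ((hasDerivAt_id u).mul (hb.mul (hb.add_const 1)))) ?_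
    simp; ring
  apply monotoneOn_of_deriv_nonneg (convex_Ioi 0)
  · exact fun x hx => (hd x hx).continuousAt.continuousWithinAt
  · exact fun x hx => (hd x (interior_subset hx)).differentiableAt.differentiableWithinAt
  · intro u hu
    have hu : 0 < u := interior_subset hu
    rw [(hd u hu).deriv]
    have hb := bF_pos hu
    have h1 := psiF_le hu
    apply mul_nonneg (by positivity)
    have h2 : u * psiF u ≤ u * (1 / 2) := mul_le_mul_of_nonneg_left h1 hu.le
    have h3 : u * psiF u = 1 - u * bF u := by unfold psiF; field_simp
    linarith

lemma sinh_ineq {v : ℝ} (hv : 0 ≤ v) : v ^ 3 * Real.cosh v ≤ Real.sinh v ^ 3 := by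
  have hc : ∀ x : ℝ, Real.cosh x ≠ 0 := fun x => (Real.cosh_pos x).ne'
  have A : ∀ x : ℝ, 0 ≤ x →
      0 ≤ 4 * (Real.sinh x * Real.cosh x) + 2 * (Real.sinh x / Real.cosh x ^ 3) - 6 * x := by
    apply mono_nonneg (f' := fun x => 8 * Real.cosh x ^ 2 - 10 - 4 / Real.cosh x ^ 2
      + 6 / Real.cosh x ^ 4)
    · intro x
      have hs := Real.hasDerivAt_sinh x
      have hh := Real.hasDerivAt_cosh x
      refine HasDerivAt.congr_deriv ((((hs.mul hh).const_mul 4).add ((hs.div (hh.pow 3) (pow_ne_zero 3 (hc x))).const_mul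
        2)).sub ((hasDerivAt_id x).const_mul 6)) ?_
      have e := Real.sinh_sq x
      have := hc x
      simp
      field_simp
      ring_nf
      rw [e]
      ring
    · simp
    · intro x _
      have h1 := Real.one_le_cosh x
      have h2 : 1 ≤ Real.cosh x ^ 2 := one_le_pow₀ h1
      have : 8 * Real.cosh x ^ 2 - 10 - 4 / Real.cosh x ^ 2 + 6 / Real.cosh x ^ 4
          = (Real.cosh x ^ 2 - 1) ^ 2 * (8 * Real.cosh x ^ 2 + 6) / Real.cosh x ^ 4 := by
        have := hc x
        field_simp; ring
      rw [this]; positivity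
  have B : ∀ x : ℝ, 0 ≤ x →
      0 ≤ 2 * Real.sinh x ^ 2 + (Real.sinh x / Real.cosh x) ^ 2 - 3 * x ^ 2 := by
    apply mono_nonneg _ (by simp) A
    intro x
    have hs := Real.hasDerivAt_sinh x
    have hh := Real.hasDerivAt_cosh x
    refine HasDerivAt.congr_deriv ((((hs.pow 2).const_mul 2).add ((hs.div hh (hc x)).pow 2)).sub
        (((hasDerivAt_id x).pow 2).const_mul 3)) ?_
    have e := Real.sinh_sq x
    have := hc x
    simp
    field_simp
    ring_nf
    have e3 : Real.sinh x ^ 3 = Real.sinh x * (Real.cosh x ^ 2 - 1) := by rw [← e]; ring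
    rw [e3]
    ring
  have C : ∀ x : ℝ, 0 ≤ x → 0 ≤ Real.sinh x ^ 3 / Real.cosh x - x ^ 3 := by
    apply mono_nonneg _ (by simp) B
    intro x
    have hs := Real.hasDerivAt_sinh x
    have hh := Real.hasDerivAt_cosh x
    refine HasDerivAt.congr_deriv (((hs.pow 3).div hh (hc x)).sub ((hasDerivAt_id x).pow 3)) ?_
    have e := Real.sinh_sq x
    have := hc x
    simp
    field_simp
    have e3 : Real.sinh x ^ 4 = Real.sinh x ^ 2 * (Real.cosh x ^ 2 - 1) := by rw [← e]; ring
    ring_nf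
    rw [e3]
    ring
  have := C v hv
  rw [sub_nonneg, le_div_iff₀ (Real.cosh_pos v)] at this
  exact this

lemma phiF_mono : MonotoneOn phiF (Set.Ioi 0) := by
  have hd : ∀ u : ℝ, 0 < u →
      HasDerivAt phiF (-(bF u * (bF u + 1) * (2 * bF u + 1)) + 2 / u ^ 3) u := by
    intro u hu
    have hb := bF_deriv hu
    have h2 : HasDerivAt (fun x : ℝ => 1 / x ^ 2) (-2 / u ^ 3) u := by
      refine HasDerivAt.congr_deriv ((hasDerivAt_const u (1 : ℝ)).div ((hasDerivAt_id u).pow 2) (pow_ne_zero 2 hu.ne')) ?_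
      simp
      field_simp
    refine HasDerivAt.congr_deriv ((hb.mul (hb.add_const 1)).sub h2) ?_
    ring
  apply monotoneOn_of_deriv_nonneg (convex_Ioi 0)
  · exact fun x hx => (hd x hx).continuousAt.continuousWithinAt
  · exact fun x hx => (hd x (interior_subset hx)).differentiableAt.differentiableWithinAt
  · intro u hu
    have hu : 0 < u := interior_subset hu
    rw [(hd u hu).deriv]
    have h := exp_sub_pos hu
    have hs := sinh_ineq (v := u / 2) (by linarith)
    have hp := Real.exp_pos (u / 2)
    have e2 : Real.exp u = Real.exp (u / 2) ^ 2 := by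
      rw [sq, ← Real.exp_add]; congr 1; ring
    rw [Real.sinh_eq, Real.cosh_eq, Real.exp_neg] at hs
    have hkey : u ^ 3 * (Real.exp u * (Real.exp u + 1)) ≤ 2 * (Real.exp u - 1) ^ 3 := by
      rw [e2]
      have := mul_le_mul_of_nonneg_left hs (by positivity : 0 ≤ 16 * Real.exp (u / 2) ^ 3)
      calc _ = 16 * Real.exp (u / 2) ^ 3 *
            ((u / 2) ^ 3 * ((Real.exp (u / 2) + (Real.exp (u / 2))⁻¹) / 2)) := by field_simp; ring
        _ ≤ _ := this
        _ = _ := by field_simp; ring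
    have : bF u * (bF u + 1) * (2 * bF u + 1)
        = Real.exp u * (Real.exp u + 1) / (Real.exp u - 1) ^ 3 := by
      unfold bF; field_simp; ring
    rw [this]
    have : Real.exp u * (Real.exp u + 1) / (Real.exp u - 1) ^ 3 ≤ 2 / u ^ 3 := by
      rw [div_le_div_iff₀ (by positivity) (by positivity)]
      linarith
    linarith

/-- Comparison of the sum of a monotone derivative with its antiderivative. -/
lemma sum_compare {f f' : ℝ → ℝ} (hd : ∀ x, 0 < x → HasDerivAt f (f' x) x)
    (hm : MonotoneOn f' (Set.Ioi 0)) (hlim : Tendsto f atTop (𝓝 0)) {s : ℝ} (hs : 0 < s)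
    (hsum : Summable (fun k : ℕ => f' (((k : ℝ) + 1) * s))) :
    s * f' s - f s ≤ s * ∑' k : ℕ, f' (((k : ℝ) + 1) * s) ∧
      s * ∑' k : ℕ, f' (((k : ℝ) + 1) * s) ≤ -f s := by
  have step : ∀ k : ℕ, s * f' (((k : ℝ) + 1) * s) ≤ f (((k : ℝ) + 2) * s) - f (((k : ℝ) + 1) * s) ∧
      f (((k : ℝ) + 2) * s) - f (((k : ℝ) + 1) * s) ≤ s * f' (((k : ℝ) + 2) * s) := by
    intro k
    have hk : (0 : ℝ) < ((k : ℝ) + 1) * s := by positivity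
    have hlt : ((k : ℝ) + 1) * s < ((k : ℝ) + 2) * s := by nlinarith
    obtain ⟨c, hc, hce⟩ := exists_hasDerivAt_eq_slope f f' hlt
      (fun x hx => (hd x (hk.trans_le hx.1)).continuousAt.continuousWithinAt)
      (fun x hx => hd x (hk.trans hx.1))
    have hc0 : 0 < c := hk.trans hc.1
    have e : ((k : ℝ) + 2) * s - ((k : ℝ) + 1) * s = s := by ring
    rw [e, eq_div_iff hs.ne'] at hce
    rw [← hce, mul_comm (f' c)]
    exact ⟨mul_le_mul_of_nonneg_left (hm hk hc0 hc.1.le) hs.le,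
      mul_le_mul_of_nonneg_left (hm hc0 (hk.trans hlt) hc.2.le) hs.le⟩
  have htop : Tendsto (fun N : ℕ => ((N : ℝ) + 1) * s) atTop atTop :=
    (tendsto_atTop_add_const_right _ _ tendsto_natCast_atTop_atTop).atTop_mul_const hs
  have hfN : Tendsto (fun N : ℕ => f (((N : ℝ) + 1) * s)) atTop (𝓝 0) := hlim.comp htop
  have hS : Tendsto (fun N : ℕ => s * ∑ k ∈ Finset.range N, f' (((k : ℝ) + 1) * s)) atTop
      (𝓝 (s * ∑' k : ℕ, f' (((k : ℝ) + 1) * s))) := hsum.hasSum.tendsto_sum_nat.const_mul s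
  have up : ∀ N : ℕ, s * ∑ k ∈ Finset.range N, f' (((k : ℝ) + 1) * s)
      ≤ f (((N : ℝ) + 1) * s) - f s := by
    intro N
    induction N with
    | zero => simp
    | succ N ih =>
      rw [Finset.sum_range_succ, mul_add]
      have := (step N).1
      have e : (((N + 1 : ℕ) : ℝ) + 1) = (N : ℝ) + 2 := by push_cast; ring
      rw [e]; linarith
  have lo : ∀ N : ℕ, s * f' s + f (((N : ℝ) + 1) * s) - f s
      ≤ s * ∑ k ∈ Finset.range (N + 1), f' (((k : ℝ) + 1) * s) := by
    intro N
    induction N with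
    | zero => simp
    | succ N ih =>
      rw [Finset.sum_range_succ, mul_add]
      have := (step N).2
      have e : (((N + 1 : ℕ) : ℝ) + 1) = (N : ℝ) + 2 := by push_cast; ring
      rw [e]; linarith
  constructor
  · have h1 : Tendsto (fun N : ℕ => s * f' s + f (((N : ℝ) + 1) * s) - f s) atTop
        (𝓝 (s * f' s + 0 - f s)) := (hfN.const_add _).sub_const _
    have := le_of_tendsto_of_tendsto' h1 (hS.comp (tendsto_add_atTop_nat 1)) lo
    linarith
  · have h1 := hfN.sub_const (f s)
    have := le_of_tendsto_of_tendsto' hS h1 up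
    linarith

lemma bF_tendsto : Tendsto bF atTop (𝓝 0) := by
  have h : Tendsto (fun u => Real.exp u - 1) atTop atTop :=
    tendsto_atTop_add_const_right _ _ Real.tendsto_exp_atTop
  have h2 := h.inv_tendsto_atTop
  refine h2.congr ?_
  intro x; simp [bF]

lemma psiF_tendsto : Tendsto psiF atTop (𝓝 0) := by
  have h := tendsto_inv_atTop_zero (𝕜 := ℝ).sub bF_tendsto
  rw [sub_zero] at h
  refine h.congr ?_
  intro x; simp [psiF]

lemma gF_tendsto : Tendsto gF atTop (𝓝 0) := by
  have h2 : Tendsto (fun x : ℝ => Real.exp (-x / 2)) atTop (𝓝 0) := by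
    apply Real.tendsto_exp_atBot.comp
    have : Tendsto (fun x : ℝ => x * (-1 / 2)) atTop atBot :=
      tendsto_id.atTop_mul_const_of_neg (by norm_num)
    refine this.congr ?_
    intro x; ring
  refine squeeze_zero' ?_ ?_ h2
  · filter_upwards [eventually_gt_atTop 0] with x hx
    exact mul_nonneg hx.le (bF_pos hx).le
  · filter_upwards [eventually_gt_atTop 0] with x hx
    exact bF_le hx

lemma summ_exp {a : ℝ} (ha : 0 < a) : Summable (fun n : ℕ => Real.exp (-(((n : ℝ) + 1) * a) / 2)) := by
  have h : Summable (fun n : ℕ => Real.exp ((n : ℝ) * (-a / 2))) :=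
    Real.summable_exp_nat_mul_iff.2 (by linarith)
  refine ((summable_nat_add_iff 1).2 h).congr ?_
  intro n; push_cast; congr 1; ring

lemma nb_le {a r : ℝ} (ha : 0 < a) (hr : a ≤ r) (n : ℕ) :
    ((n : ℝ) + 1) * bF (((n : ℝ) + 1) * r) ≤ Real.exp (-(((n : ℝ) + 1) * a) / 2) / a := by
  have hr0 : 0 < r := ha.trans_le hr
  have hx : 0 < ((n : ℝ) + 1) * r := by positivity
  have h1 := bF_le hx
  have h2 : Real.exp (-(((n : ℝ) + 1) * r) / 2) ≤ Real.exp (-(((n : ℝ) + 1) * a) / 2) := by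
    apply Real.exp_le_exp.2
    have : ((n : ℝ) + 1) * a ≤ ((n : ℝ) + 1) * r := by gcongr
    linarith
  rw [le_div_iff₀ ha]
  have h3 := bF_pos hx
  calc ((n : ℝ) + 1) * bF (((n : ℝ) + 1) * r) * a ≤ ((n : ℝ) + 1) * bF (((n : ℝ) + 1) * r) * r := by
        gcongr
    _ = ((n : ℝ) + 1) * r * bF (((n : ℝ) + 1) * r) := by ring
    _ ≤ _ := h1.trans h2

lemma b_le {a r : ℝ} (ha : 0 < a) (hr : a ≤ r) (n : ℕ) :
    bF (((n : ℝ) + 1) * r) ≤ Real.exp (-(((n : ℝ) + 1) * a) / 2) / a := by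
  have hr0 : 0 < r := ha.trans_le hr
  have hx : 0 < ((n : ℝ) + 1) * r := by positivity
  refine le_trans ?_ (nb_le ha hr n)
  have h3 := bF_pos hx
  have : (0 : ℝ) ≤ n := n.cast_nonneg
  nlinarith

lemma b_le' {a r : ℝ} (ha : 0 < a) (hr : a ≤ r) (n : ℕ) :
    bF (((n : ℝ) + 1) * r) ≤ 1 / a := by
  refine (b_le ha hr n).trans ?_
  gcongr
  apply Real.exp_le_one_iff.2
  have : 0 ≤ ((n : ℝ) + 1) * a := by positivity
  linarith

lemma nbb_le {a r : ℝ} (ha : 0 < a) (hr : a ≤ r) (n : ℕ) :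
    ((n : ℝ) + 1) * (bF (((n : ℝ) + 1) * r) * (bF (((n : ℝ) + 1) * r) + 1)) ≤
      Real.exp (-(((n : ℝ) + 1) * a) / 2) / a * (1 / a + 1) := by
  have hr0 : 0 < r := ha.trans_le hr
  have hx : 0 < ((n : ℝ) + 1) * r := by positivity
  have h3 := bF_pos hx
  rw [← mul_assoc]
  have := b_le' ha hr n
  have := nb_le ha hr n
  gcongr

lemma summ_b {s : ℝ} (hs : 0 < s) : Summable (fun n : ℕ => bF (((n : ℝ) + 1) * s)) :=
  Summable.of_nonneg_of_le (fun n => (bF_pos (by positivity)).le) (fun n => b_le hs le_rfl n)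
    ((summ_exp hs).div_const _)

lemma summ_nb {s : ℝ} (hs : 0 < s) : Summable (fun n : ℕ => ((n : ℝ) + 1) * bF (((n : ℝ) + 1) * s)) :=
  Summable.of_nonneg_of_le
    (fun n => mul_nonneg (by positivity) (bF_pos (by positivity)).le) (fun n => nb_le hs le_rfl n)
    ((summ_exp hs).div_const _)

lemma summ_nbb {s : ℝ} (hs : 0 < s) : Summable (fun n : ℕ =>
    ((n : ℝ) + 1) * (bF (((n : ℝ) + 1) * s) * (bF (((n : ℝ) + 1) * s) + 1))) :=
  Summable.of_nonneg_of_le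
    (fun n => by
      have : 0 < bF (((n : ℝ) + 1) * s) := bF_pos (by positivity)
      positivity) (fun n => nbb_le hs le_rfl n)
    (((summ_exp hs).div_const _).mul_right _)

lemma DSum_deriv {s : ℝ} (hs : 0 < s) : HasDerivAt DSum
    (∑' n : ℕ, -(((n : ℝ) + 1) * (bF (((n : ℝ) + 1) * s) * (bF (((n : ℝ) + 1) * s) + 1)))) s := by
  have ha : 0 < s / 2 := by linarith
  refine hasDerivAt_tsum_of_isPreconnected (t := Set.Ioi (s / 2)) (y₀ := s)
    (g := fun (n : ℕ) (s : ℝ) => 1 / (Real.exp (((n : ℝ) + 1) * s) - 1))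
    (g' := fun (n : ℕ) (s : ℝ) =>
      -(((n : ℝ) + 1) * (bF (((n : ℝ) + 1) * s) * (bF (((n : ℝ) + 1) * s) + 1))))
    (((summ_exp ha).div_const (s / 2)).mul_right (1 / (s / 2) + 1)) isOpen_Ioi
    isPreconnected_Ioi ?_ ?_ ?_ ?_ ?_
  · intro n y hy
    have hy : s / 2 < y := hy
    have hx : 0 < ((n : ℝ) + 1) * y := by have := ha.trans hy; positivity
    have h1 : HasDerivAt (fun y : ℝ => ((n : ℝ) + 1) * y) ((n : ℝ) + 1) y := by
      simpa using (hasDerivAt_id y).const_mul ((n : ℝ) + 1)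
    refine HasDerivAt.congr_deriv ((bF_deriv hx).comp y h1) ?_
    ring
  · intro n y hy
    have hy : s / 2 < y := hy
    have hx : 0 < ((n : ℝ) + 1) * y := by have := ha.trans hy; positivity
    have := bF_pos hx
    rw [norm_neg, Real.norm_of_nonneg (by positivity)]
    exact nbb_le ha hy.le n
  · exact Set.mem_Ioi.2 (by linarith)
  · exact summ_b hs
  · exact Set.mem_Ioi.2 (by linarith)

lemma LOne_deriv {s : ℝ} (hs : 0 < s) : HasDerivAt LOne
    (-∑' n : ℕ, ((n : ℝ) + 1) * bF (((n : ℝ) + 1) * s)) s := by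
  have ha : 0 < s / 2 := by linarith
  have hlt : ∀ (n : ℕ) (y : ℝ), 0 < y → Real.exp (-y * ((n : ℝ) + 1)) < 1 := by
    intro n y hy
    apply Real.exp_lt_one_iff.2
    have : 0 < y * ((n : ℝ) + 1) := by positivity
    linarith
  refine HasDerivAt.neg (f := fun s => ∑' ℓ : ℕ, Real.log (1 - Real.exp (-s * ((ℓ : ℝ) + 1)))) ?_
  refine hasDerivAt_tsum_of_isPreconnected (t := Set.Ioi (s / 2)) (y₀ := s)
    (g := fun (n : ℕ) (s : ℝ) => Real.log (1 - Real.exp (-s * ((n : ℝ) + 1))))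
    (g' := fun (n : ℕ) (s : ℝ) => ((n : ℝ) + 1) * bF (((n : ℝ) + 1) * s))
    ((summ_exp ha).div_const (s / 2)) isOpen_Ioi
    isPreconnected_Ioi ?_ ?_ ?_ ?_ ?_
  · intro n y hy
    have hy : s / 2 < y := hy
    have hy0 : 0 < y := ha.trans hy
    have hx : 0 < ((n : ℝ) + 1) * y := by positivity
    have h1 : HasDerivAt (fun y : ℝ => -y * ((n : ℝ) + 1)) (-((n : ℝ) + 1)) y := by
      simpa using (hasDerivAt_id y).neg.mul_const ((n : ℝ) + 1)
    have h2 := (h1.exp.const_sub 1).log (by have := hlt n y hy0; linarith)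
    refine HasDerivAt.congr_deriv (h2) ?_
    have e : -y * ((n : ℝ) + 1) = -(((n : ℝ) + 1) * y) := by ring
    have h3 := exp_sub_pos hx
    rw [e, Real.exp_neg, bF]
    have h4 := Real.exp_pos (((n : ℝ) + 1) * y)
    have h5 : 1 - (Real.exp (((n : ℝ) + 1) * y))⁻¹
      = (Real.exp (((n : ℝ) + 1) * y) - 1) / Real.exp (((n : ℝ) + 1) * y) := by field_simp
    rw [h5]
    field_simp
  · intro n y hy
    have hy : s / 2 < y := hy
    have hx : 0 < ((n : ℝ) + 1) * y := by have := ha.trans hy; positivity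
    have := bF_pos hx
    rw [Real.norm_of_nonneg (by positivity)]
    exact nb_le ha hy.le n
  · exact Set.mem_Ioi.2 (by linarith)
  · have h : Summable (fun n : ℕ => -Real.exp (-s * ((n : ℝ) + 1))) := by
      refine ((summ_exp (a := 2 * s) (by linarith)).neg).congr ?_
      intro n; congr 2; ring
    have := Real.summable_log_one_add_of_summable h
    refine this.congr ?_
    intro n; rw [← sub_eq_add_neg]
  · exact Set.mem_Ioi.2 (by linarith)

lemma swap {s : ℝ} (hs : 0 < s) :
    Summable (fun k : ℕ => bF (((k : ℝ) + 1) * s) * (bF (((k : ℝ) + 1) * s) + 1)) ∧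
    ∑' n : ℕ, ((n : ℝ) + 1) * bF (((n : ℝ) + 1) * s) =
      ∑' k : ℕ, bF (((k : ℝ) + 1) * s) * (bF (((k : ℝ) + 1) * s) + 1) := by
  have H1 : ∀ n : ℕ, HasSum (fun k : ℕ => ((n : ℝ) + 1) * Real.exp (-(((n : ℝ) + 1) * ((k : ℝ) + 1) * s)))
      (((n : ℝ) + 1) * bF (((n : ℝ) + 1) * s)) := by
    intro n
    have hx : 0 < ((n : ℝ) + 1) * s := by positivity
    apply HasSum.mul_left
    have h := (hasSum_geometric_of_lt_one (Real.exp_pos (-(((n : ℝ) + 1) * s))).le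
      (Real.exp_lt_one_iff.2 (by linarith))).mul_left (Real.exp (-(((n : ℝ) + 1) * s)))
    convert h using 1
    · funext k
      rw [← Real.exp_nat_mul, ← Real.exp_add]; congr 1; ring
    · have h3 := exp_sub_pos hx
      rw [Real.exp_neg, bF]
      have h4 := Real.exp_pos (((n : ℝ) + 1) * s)
      have h5 : 1 - (Real.exp (((n : ℝ) + 1) * s))⁻¹
        = (Real.exp (((n : ℝ) + 1) * s) - 1) / Real.exp (((n : ℝ) + 1) * s) := by field_simp
      rw [h5]
      field_simp
  have H2 : ∀ k : ℕ, HasSum (fun n : ℕ => ((n : ℝ) + 1) * Real.exp (-(((n : ℝ) + 1) * ((k : ℝ) + 1) * s)))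
      (bF (((k : ℝ) + 1) * s) * (bF (((k : ℝ) + 1) * s) + 1)) := by
    intro k
    have hx : 0 < ((k : ℝ) + 1) * s := by positivity
    have h := hasSum_coe_mul_geometric_of_norm_lt_one (r := Real.exp (-(((k : ℝ) + 1) * s)))
      (by rw [Real.norm_of_nonneg (Real.exp_pos _).le]; exact Real.exp_lt_one_iff.2 (by linarith))
    have h' := (hasSum_nat_add_iff' 1).2 h
    convert h' using 1
    · rfl
    · funext n
      rw [← Real.exp_nat_mul]; push_cast; congr 2; ring
    · have h3 := exp_sub_pos hx
      simp only [Finset.range_one, Finset.sum_singleton, Nat.cast_zero, zero_mul, sub_zero]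
      rw [Real.exp_neg, bF]
      have h4 := Real.exp_pos (((k : ℝ) + 1) * s)
      have h5 : 1 - (Real.exp (((k : ℝ) + 1) * s))⁻¹
        = (Real.exp (((k : ℝ) + 1) * s) - 1) / Real.exp (((k : ℝ) + 1) * s) := by field_simp
      rw [h5]
      field_simp
      ring
  have HS : Summable (fun p : ℕ × ℕ =>
      ((p.1 : ℝ) + 1) * Real.exp (-(((p.1 : ℝ) + 1) * ((p.2 : ℝ) + 1) * s))) := by
    rw [summable_prod_of_nonneg (fun p => by positivity)]
    refine ⟨fun n => (H1 n).summable, ?_⟩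
    refine (summ_nb hs).congr ?_
    intro n; exact (H1 n).tsum_eq.symm
  constructor
  · have := HS.prod_symm.prod
    refine this.congr ?_
    intro k; exact (H2 k).tsum_eq
  · have := HS.tsum_comm (f := fun n k : ℕ =>
      ((n : ℝ) + 1) * Real.exp (-(((n : ℝ) + 1) * ((k : ℝ) + 1) * s)))
    simp_rw [(H1 _).tsum_eq, (H2 _).tsum_eq] at this
    exact this.symm

lemma zeta_two_shift {s : ℝ} (hs : 0 < s) :
    HasSum (fun k : ℕ => 1 / (((k : ℝ) + 1) * s) ^ 2) (π ^ 2 / 6 / s ^ 2) := by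
  have h := (hasSum_nat_add_iff' 1).2 hasSum_zeta_two
  have h2 := h.div_const (s ^ 2)
  convert h2 using 1
  · rfl
  · funext k; push_cast; field_simp
  · simp

lemma L_bound {s : ℝ} (hs : 0 < s) :
    |(-∑' n : ℕ, ((n : ℝ) + 1) * bF (((n : ℝ) + 1) * s)) - (-(π ^ 2 / 6 / s ^ 2) + 1 / (2 * s))|
      ≤ 1 / 4 := by
  obtain ⟨h1, h2⟩ := swap hs
  have hz := zeta_two_shift hs
  have h3 : HasSum (fun k : ℕ => phiF (((k : ℝ) + 1) * s))
      ((∑' n : ℕ, ((n : ℝ) + 1) * bF (((n : ℝ) + 1) * s)) - π ^ 2 / 6 / s ^ 2) := by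
    rw [h2]; exact h1.hasSum.sub hz
  obtain ⟨lo, up⟩ := sum_compare (fun x hx => psiF_deriv hx) phiF_mono psiF_tendsto hs h3.summable
  rw [h3.tsum_eq] at lo up
  set T := (∑' n : ℕ, ((n : ℝ) + 1) * bF (((n : ℝ) + 1) * s))
  have a1 := psiF_le hs
  have a2 := psiF_ge hs
  have a3 := mul_le_mul_of_nonneg_left (phiF_ge hs) hs.le
  have e : -T - (-(π ^ 2 / 6 / s ^ 2) + 1 / (2 * s)) = (-(s * (T - π ^ 2 / 6 / s ^ 2)) - 1 / 2) / s := by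
    field_simp; ring
  rw [e, abs_div, abs_of_pos hs, div_le_iff₀ hs, abs_le]
  constructor <;> linarith

lemma D_bound {s : ℝ} (hs : 0 < s) (hs1 : s ≤ 1) :
    |(DSum s + s * ∑' n : ℕ, -(((n : ℝ) + 1) * (bF (((n : ℝ) + 1) * s) * (bF (((n : ℝ) + 1) * s) + 1))))
      - (-(1 / s))| ≤ 2 := by
  have h3 : HasSum (fun k : ℕ => gamF (((k : ℝ) + 1) * s))
      (DSum s + s * ∑' n : ℕ, -(((n : ℝ) + 1) * (bF (((n : ℝ) + 1) * s) * (bF (((n : ℝ) + 1) * s) + 1)))) := by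
    convert (summ_b hs).hasSum.add ((summ_nbb hs).neg.hasSum.mul_left s) using 1
    · funext k; simp [gamF]; ring
    · rfl
  obtain ⟨lo, up⟩ := sum_compare (fun x hx => gF_deriv hx) gamF_mono gF_tendsto hs h3.summable
  rw [h3.tsum_eq] at lo up
  set T := DSum s + s * ∑' n : ℕ, -(((n : ℝ) + 1) * (bF (((n : ℝ) + 1) * s) * (bF (((n : ℝ) + 1) * s) + 1)))
  have a1 := mul_le_mul_of_nonneg_left (psiF_le hs) hs.le
  have a2 : 0 ≤ s * psiF s := mul_nonneg hs.le (by have := psiF_ge hs; linarith)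
  have a3 := mul_le_mul_of_nonneg_left (gamF_ge hs hs1) hs.le
  have e0 : gF s = 1 - s * psiF s := by unfold gF psiF; field_simp; ring
  rw [e0] at lo up
  have e : T - (-(1 / s)) = (s * T + 1) / s := by
    field_simp; ring
  rw [e, abs_div, abs_of_pos hs, div_le_iff₀ hs, abs_le]
  constructor <;> linarith

theorem stmt12 (α : ℝ) (hα : 1 < α) (hirr : Irrational α) :
    (fun t : ℝ =>
        deriv (LHat α) t - (-(π ^ 2) / (6 * α * t ^ 2) + (1 - α⁻¹) / (2 * t)))
      =O[𝓝[>] (0 : ℝ)] (fun t => (Real.sqrt t)⁻¹) := by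
  have hα0 : 0 < α := by linarith
  refine IsBigO.of_bound (α + 1) ?_
  have hev : Set.Ioo (0 : ℝ) α⁻¹ ∈ 𝓝[>] (0 : ℝ) := Ioo_mem_nhdsGT (by positivity)
  filter_upwards [hev] with t ht
  have ht0 : 0 < t := ht.1
  have hs : 0 < α * t := by positivity
  have hs1 : α * t ≤ 1 := by
    have := mul_le_mul_of_nonneg_left ht.2.le hα0.le
    rwa [mul_inv_cancel₀ hα0.ne'] at this
  have hlin : HasDerivAt (fun t : ℝ => α * t) α t := by
    simpa using (hasDerivAt_id t).const_mul α
  have hL := (LOne_deriv hs).comp t hlin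
  have hD := (DSum_deriv hs).comp t hlin
  have hH := hL.add (((hasDerivAt_id t).div_const 2).mul hD)
  have hB1 := L_bound hs
  have hB2 := D_bound hs hs1
  set T1 := ∑' n : ℕ, ((n : ℝ) + 1) * bF (((n : ℝ) + 1) * (α * t))
  set T2 := ∑' n : ℕ, -(((n : ℝ) + 1) * (bF (((n : ℝ) + 1) * (α * t)) * (bF (((n : ℝ) + 1) * (α * t)) + 1)))
  have hH' : deriv (LHat α) t = -T1 * α + (1 / 2 * DSum (α * t) + t / 2 * (T2 * α)) := hH.deriv
  have key : deriv (LHat α) t - (-(π ^ 2) / (6 * α * t ^ 2) + (1 - α⁻¹) / (2 * t))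
      = α * (-T1 - (-(π ^ 2 / 6 / (α * t) ^ 2) + 1 / (2 * (α * t))))
        + 1 / 2 * ((DSum (α * t) + α * t * T2) - (-(1 / (α * t)))) := by
    rw [hH']; field_simp; ring
  have hle : |deriv (LHat α) t - (-(π ^ 2) / (6 * α * t ^ 2) + (1 - α⁻¹) / (2 * t))| ≤ α + 1 := by
    rw [key]
    refine (abs_add_le _ _).trans ?_
    rw [abs_mul, abs_mul, abs_of_pos hα0, abs_of_pos (by norm_num : (0 : ℝ) < 1 / 2)]
    have := mul_le_mul_of_nonneg_left hB1 hα0.le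
    linarith
  rw [Real.norm_eq_abs, Real.norm_of_nonneg (by positivity)]
  refine hle.trans (le_mul_of_one_le_right (by positivity) ?_)
  apply (one_le_inv₀ (Real.sqrt_pos.2 ht0)).2
  rw [Real.sqrt_le_one]
  nlinarith
end

section
/- Let α > 1 be an irrational real number and define L̂_α(t) = L_1(αt) + (t/2)·D(αt) for t > 0. Then as t → 0⁺, the second derivative satisfies L̂_α''(t) = π²/(3αt³) + O(1/t²). -/
open Filter Topology Real Asymptotics

noncomputable def kf (x : ℝ) : ℝ := (Real.exp x - 1)⁻¹
noncomputable def F0 (c x : ℝ) : ℝ := kf x * (1 + c * x)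
noncomputable def F1 (c x : ℝ) : ℝ := -(kf x + kf x ^ 2) * (1 + c * x) + c * kf x
noncomputable def F2 (c x : ℝ) : ℝ :=
  (1 + 2 * kf x) * (kf x + kf x ^ 2) * (1 + c * x) - 2 * c * (kf x + kf x ^ 2)

lemma exp_sub_pos_s13 {x : ℝ} (hx : 0 < x) : 0 < Real.exp x - 1 := by
  have := Real.add_one_lt_exp hx.ne'
  linarith

lemma kf_pos {x : ℝ} (hx : 0 < x) : 0 < kf x := inv_pos.2 (exp_sub_pos_s13 hx)

lemma kf_le {x : ℝ} (hx : 0 < x) : kf x ≤ 24 / x ^ 4 := by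
  have h := Real.sum_le_exp_of_nonneg hx.le 5
  have h2 : x ^ 4 / 24 ≤ Real.exp x - 1 := by
    simp [Finset.sum_range_succ, Nat.factorial] at h
    have : 0 < x ^ 2 := by positivity
    have : 0 < x ^ 3 := by positivity
    linarith
  unfold kf
  rw [show 24 / x ^ 4 = (x ^ 4 / 24)⁻¹ by rw [inv_div]]
  exact inv_anti₀ (by positivity) h2

lemma hasDerivAt_kf {x : ℝ} (hx : 0 < x) : HasDerivAt kf (-(kf x + kf x ^ 2)) x := by
  have h := ((Real.hasDerivAt_exp x).sub_const 1).inv (exp_sub_pos_s13 hx).ne'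
  refine h.congr_deriv ?_
  have := (exp_sub_pos_s13 hx).ne'
  unfold kf
  field_simp
  ring

lemma hasDerivAt_F0 (c : ℝ) {x : ℝ} (hx : 0 < x) : HasDerivAt (F0 c) (F1 c x) x := by
  have h := (hasDerivAt_kf hx).mul (((hasDerivAt_id x).const_mul c).const_add 1)
  refine h.congr_deriv ?_
  simp only [F1, id]; ring

lemma hasDerivAt_F1 (c : ℝ) {x : ℝ} (hx : 0 < x) : HasDerivAt (F1 c) (F2 c x) x := by
  have hk := hasDerivAt_kf hx
  have h := ((hk.add (hk.pow 2)).neg.mul (((hasDerivAt_id x).const_mul c).const_add 1)).add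
    (hk.const_mul c)
  refine h.congr_deriv ?_
  simp [F2]; ring

lemma F1_bound {c δ : ℝ} (hc : 0 < c) (hδ : 0 < δ) :
    ∃ C, 0 < C ∧ ∀ x, δ ≤ x → |F1 c x| ≤ C / x ^ 3 ∧ |F2 c x| ≤ C / x ^ 3 := by
  set K := 24 / δ ^ 4 with hK
  have hKp : 0 < K := by positivity
  set A := (1 + 2 * K) * (1 + K) * (1 / δ + c) + 2 * c * (1 + K) / δ with hA
  have hAp : 0 < A := by positivity
  refine ⟨24 * A, by positivity, fun x hx => ?_⟩
  have hx0 : 0 < x := hδ.trans_le hx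
  have hk := kf_pos hx0
  have hkx := kf_le hx0
  have hkK : kf x ≤ K := hkx.trans (by rw [hK]; gcongr)
  have h1 : 1 ≤ x / δ := by rwa [le_div_iff₀ hδ, one_mul]
  have hfin : kf x * (A * x) ≤ 24 * A / x ^ 3 := by
    calc kf x * (A * x) ≤ 24 / x ^ 4 * (A * x) := by gcongr
      _ = 24 * A / x ^ 3 := by field_simp
  have e1 : 1 + c * x ≤ (1 / δ + c) * x := by
    have : (1 / δ + c) * x = x / δ + c * x := by ring
    linarith
  have e2 : (1 + 2 * K) * (1 + K) * (1 + c * x) + 2 * c * (1 + K) ≤ A * x := by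
    calc _ ≤ (1 + 2 * K) * (1 + K) * ((1 / δ + c) * x) + 2 * c * (1 + K) * (x / δ) := by
          have h3 : 2 * c * (1 + K) ≤ 2 * c * (1 + K) * (x / δ) :=
            le_mul_of_one_le_right (by positivity) h1
          have h4 : (1 + 2 * K) * (1 + K) * (1 + c * x) ≤
              (1 + 2 * K) * (1 + K) * ((1 / δ + c) * x) := by gcongr
          linarith
      _ = A * x := by rw [hA]; ring
  have q0 : 0 < 1 + c * x := by positivity
  constructor
  · refine le_trans ?_ hfin
    have : F1 c x = kf x * (-((1 + kf x) * (1 + c * x)) + c) := by unfold F1; ring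
    rw [this, abs_mul, abs_of_pos hk]
    refine mul_le_mul_of_nonneg_left (le_trans ?_ e2) hk.le
    refine (abs_add_le _ _).trans ?_
    rw [abs_neg, abs_of_pos (by positivity : 0 < (1 + kf x) * (1 + c * x)), abs_of_pos hc]
    have : (1 + kf x) ≤ (1 + 2 * K) * (1 + K) := by nlinarith
    have := mul_le_mul_of_nonneg_right this q0.le
    nlinarith
  · refine le_trans ?_ hfin
    have : F2 c x = kf x * ((1 + 2 * kf x) * (1 + kf x) * (1 + c * x) - 2 * c * (1 + kf x)) := by
      unfold F2; ring
    rw [this, abs_mul, abs_of_pos hk]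
    refine mul_le_mul_of_nonneg_left (le_trans ?_ e2) hk.le
    refine (abs_sub _ _).trans ?_
    rw [abs_of_pos (by positivity : 0 < (1 + 2 * kf x) * (1 + kf x) * (1 + c * x)),
      abs_of_pos (by positivity : 0 < 2 * c * (1 + kf x))]
    gcongr

lemma near_zero (c : ℝ) : ∃ C δ : ℝ, 0 < C ∧ 0 < δ ∧
    ∀ x, 0 < x → x < δ → |F2 c x - 2 / x ^ 3| ≤ C := by
  obtain ⟨p, hp⟩ : AnalyticAt ℝ Real.exp 0 := analyticAt_rexp
  have hE : AnalyticAt ℝ (dslope Real.exp 0) 0 := ⟨_, hp.has_fpower_series_dslope_fslope⟩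
  have hE0 : dslope Real.exp 0 0 = 1 := by simp
  set g : ℝ → ℝ := (dslope Real.exp 0)⁻¹ with hg
  have hgA : AnalyticAt ℝ g 0 := hE.inv (by rw [hE0]; exact one_ne_zero)
  obtain ⟨r, hr⟩ := hgA
  have hM : AnalyticAt ℝ (dslope g 0) 0 := ⟨_, hr.has_fpower_series_dslope_fslope⟩
  have hgA : AnalyticAt ℝ g 0 := ⟨r, hr⟩
  set q : ℝ → ℝ := fun x => dslope g 0 x + c * g x with hq
  have hqA : AnalyticAt ℝ q 0 := hM.add (analyticAt_const.mul hgA)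
  have hgx : ∀ x : ℝ, 0 < x → g x = x * kf x := by
    intro x hx
    simp only [hg, Pi.inv_apply]
    rw [dslope_of_ne _ hx.ne', slope_def_field]
    simp [kf, div_eq_mul_inv]
  have hg0 : g 0 = 1 := by simp [hg]
  have hqF : ∀ x : ℝ, 0 < x → q x = F0 c x - x⁻¹ := by
    intro x hx
    simp only [hq]
    rw [dslope_of_ne _ hx.ne', slope_def_field, hgx x hx, hg0]
    unfold F0
    have hx1 : x ≠ 0 := hx.ne'
    field_simp
    ring
  have hd1 : ∀ x : ℝ, 0 < x → deriv q x = F1 c x + (x ^ 2)⁻¹ := by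
    intro x hx
    have : q =ᶠ[𝓝 x] fun y => F0 c y - y⁻¹ := by
      filter_upwards [lt_mem_nhds hx] with y hy using hqF y hy
    rw [this.deriv_eq]
    have := ((hasDerivAt_F0 c hx).sub (hasDerivAt_inv hx.ne')).deriv
    rw [sub_neg_eq_add] at this
    exact this
  have hd2 : ∀ x : ℝ, 0 < x → deriv (deriv q) x = F2 c x - 2 / x ^ 3 := by
    intro x hx
    have : deriv q =ᶠ[𝓝 x] fun y => F1 c y + (y ^ 2)⁻¹ := by
      filter_upwards [lt_mem_nhds hx] with y hy using hd1 y hy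
    rw [this.deriv_eq]
    have h := ((hasDerivAt_F1 c hx).add ((hasDerivAt_pow 2 x).inv (by positivity))).deriv
    refine h.trans ?_
    field_simp
    norm_num
    ring
  have hcont : ContinuousAt (deriv (deriv q)) 0 := hqA.deriv.deriv.continuousAt
  have hev : ∀ᶠ x in 𝓝 (0:ℝ), |deriv (deriv q) x| < |deriv (deriv q) 0| + 1 :=
    hcont.abs.eventually_lt_const (by linarith)
  obtain ⟨δ, hδ, h⟩ := Metric.eventually_nhds_iff.1 hev
  refine ⟨|deriv (deriv q) 0| + 1, δ, by positivity, hδ, fun x hx hxd => ?_⟩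
  rw [← hd2 x hx]
  exact (h (by rw [Real.dist_eq, sub_zero, abs_of_pos hx]; exact hxd)).le

lemma R_bound {c : ℝ} (hc : 0 < c) : ∃ C, 0 < C ∧ ∀ x, 0 < x →
    |F2 c x - 2 / x ^ 3| ≤ C / (x * (1 + x) ^ 2) := by
  obtain ⟨C, δ, hC, hδ, h⟩ := near_zero c
  obtain ⟨B, hB, h'⟩ := F1_bound hc hδ
  refine ⟨C * (δ * (1 + δ) ^ 2) + (B + 2) * (1 / δ + 1) ^ 2, by positivity, fun x hx => ?_⟩
  rw [le_div_iff₀ (by positivity)]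
  rcases lt_or_ge x δ with hxd | hxd
  · calc _ ≤ C * (δ * (1 + δ) ^ 2) := by
          gcongr
          exact h x hx hxd
      _ ≤ _ := by
          have : 0 < (B + 2) * (1 / δ + 1) ^ 2 := by positivity
          linarith
  · have h1 : 1 ≤ x / δ := by rwa [le_div_iff₀ hδ, one_mul]
    have e1 : |F2 c x - 2 / x ^ 3| ≤ (B + 2) / x ^ 3 := by
      refine (abs_sub _ _).trans ?_
      rw [abs_of_pos (by positivity : 0 < 2 / x ^ 3), add_div]
      gcongr
      exact (h' x hxd).2
    have e2 : 1 + x ≤ (1 / δ + 1) * x := by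
      have : (1 / δ + 1) * x = x / δ + x := by ring
      linarith
    calc _ ≤ (B + 2) / x ^ 3 * (x * ((1 / δ + 1) * x) ^ 2) := by gcongr
      _ = (B + 2) * (1 / δ + 1) ^ 2 := by field_simp
      _ ≤ _ := by
          have : 0 < C * (δ * (1 + δ) ^ 2) := by positivity
          linarith

lemma tele (s : ℝ) (hs : 0 < s) (N : ℕ) :
    ∑ n ∈ Finset.range N, 1 / (1 + ((n : ℝ) + 1) * s) ^ 2 ≤ 1 / s := by
  have key : ∑ n ∈ Finset.range N, 1 / (1 + ((n : ℝ) + 1) * s) ^ 2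
      ≤ (1 / s) * (1 - 1 / (1 + N * s)) := by
    induction N with
    | zero => simp
    | succ N ih =>
      rw [Finset.sum_range_succ]
      have : 1 / (1 + ((N : ℝ) + 1) * s) ^ 2 ≤
          (1 / s) * (1 / (1 + N * s) - 1 / (1 + ((N : ℝ) + 1) * s)) := by
        have e : (1 / s) * (1 / (1 + N * s) - 1 / (1 + ((N : ℝ) + 1) * s))
          = 1 / ((1 + N * s) * (1 + ((N : ℝ) + 1) * s)) := by
          field_simp
          ring
        rw [e, sq]
        gcongr
        linarith
      push_cast
      linarith
  refine key.trans ?_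
  have : 0 ≤ 1 / (1 + N * s) := by positivity
  exact mul_le_of_le_one_right (by positivity) (by linarith)

lemma sum_bound {c : ℝ} (hc : 0 < c) : ∃ C, 0 < C ∧ ∀ s, 0 < s →
    |∑' n : ℕ, ((n : ℝ) + 1) * F2 c ((n + 1) * s) - π ^ 2 / (3 * s ^ 3)| ≤ C / s ^ 2 := by
  obtain ⟨C, hC, h⟩ := R_bound hc
  refine ⟨C, hC, fun s hs => ?_⟩
  set v : ℕ → ℝ := fun n => C / s * (1 / (1 + ((n : ℝ) + 1) * s) ^ 2) with hv
  have hv0 : ∀ n, 0 ≤ v n := fun n => by simp only [hv]; positivity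
  have hvs : ∀ N, ∑ n ∈ Finset.range N, v n ≤ C / s ^ 2 := by
    intro N
    simp only [hv]
    rw [← Finset.mul_sum]
    calc _ ≤ C / s * (1 / s) := by gcongr; exact tele s hs N
      _ = _ := by field_simp
  have hvsum : Summable v := summable_of_sum_range_le hv0 hvs
  have hvt : ∑' n, v n ≤ C / s ^ 2 := Real.tsum_le_of_sum_range_le hv0 hvs
  have hz : HasSum (fun n : ℕ => 1 / ((n : ℝ) + 1) ^ 2) (π ^ 2 / 6) := by
    have := (hasSum_nat_add_iff' (f := fun n : ℕ => 1 / (n : ℝ) ^ 2) 1).2 hasSum_zeta_two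
    simpa using this
  have hz2 := hz.mul_left (2 / s ^ 3)
  set w : ℕ → ℝ := fun n => ((n : ℝ) + 1) * (F2 c ((n + 1) * s) - 2 / ((n + 1) * s) ^ 3) with hw
  have hwv : ∀ n, ‖w n‖ ≤ v n := by
    intro n
    have hn : (0 : ℝ) < n + 1 := by positivity
    simp only [hw, hv]
    rw [norm_mul, Real.norm_eq_abs, Real.norm_eq_abs, abs_of_pos hn]
    calc _ ≤ ((n : ℝ) + 1) * (C / (((n + 1) * s) * (1 + (n + 1) * s) ^ 2)) := by
          gcongr
          exact h _ (by positivity)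
      _ = _ := by field_simp
  have hws : Summable w := Summable.of_norm_bounded hvsum hwv
  have heq : ∀ n : ℕ, ((n : ℝ) + 1) * F2 c ((n + 1) * s) =
      w n + 2 / s ^ 3 * (1 / ((n : ℝ) + 1) ^ 2) := by
    intro n
    simp only [hw]
    have hn : (0 : ℝ) < n + 1 := by positivity
    field_simp
    ring
  have : ∑' n : ℕ, ((n : ℝ) + 1) * F2 c ((n + 1) * s) = ∑' n, w n + 2 / s ^ 3 * (π ^ 2 / 6) := by
    rw [tsum_congr heq]
    exact (hws.hasSum.add hz2).tsum_eq
  rw [this, show ∑' n, w n + 2 / s ^ 3 * (π ^ 2 / 6) - π ^ 2 / (3 * s ^ 3) = ∑' n, w n by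
    field_simp; ring]
  exact (tsum_of_norm_bounded hvsum.hasSum hwv).trans hvt

lemma summable_inv_pow (p : ℕ) (hp : 1 < p) : Summable (fun n : ℕ => 1 / ((n : ℝ) + 1) ^ p) := by
  have := (summable_nat_add_iff (f := fun n : ℕ => 1 / (n : ℝ) ^ p) 1).2
    (Real.summable_one_div_nat_pow.2 hp)
  simpa using this

lemma summable_kf {s : ℝ} (hs : 0 < s) : Summable (fun n : ℕ => kf ((n + 1) * s)) := by
  refine Summable.of_nonneg_of_le (fun n => (kf_pos (by positivity)).le) (fun n => ?_)
    ((summable_inv_pow 4 (by norm_num)).mul_left (24 / s ^ 4))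
  refine (kf_le (by positivity)).trans (le_of_eq ?_)
  field_simp

lemma summable_kf_div {s : ℝ} (hs : 0 < s) :
    Summable (fun n : ℕ => 1 / ((n : ℝ) + 1) * kf ((n + 1) * s)) := by
  refine Summable.of_nonneg_of_le
    (fun n => mul_nonneg (by positivity) (kf_pos (by positivity)).le) (fun n => ?_) (summable_kf hs)
  refine mul_le_of_le_one_left (kf_pos (by positivity)).le ?_
  rw [div_le_one (by positivity)]
  have : (0 : ℝ) ≤ n := by positivity
  linarith

lemma LOne_eq {s : ℝ} (hs : 0 < s) :
    LOne s = ∑' n : ℕ, 1 / ((n : ℝ) + 1) * kf ((n + 1) * s) := by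
  set f : ℕ → ℕ → ℝ := fun m l => 1 / ((m : ℝ) + 1) * Real.exp (-((m + 1) * s)) ^ (l + 1) with hf
  have hrow : ∀ m, HasSum (f m) (1 / ((m : ℝ) + 1) * kf ((m + 1) * s)) := by
    intro m
    refine HasSum.mul_left _ ?_
    have hx : 0 < ((m : ℝ) + 1) * s := by positivity
    have h1 : Real.exp (-((m + 1) * s)) < 1 := Real.exp_lt_one_iff.2 (by linarith)
    have := (hasSum_geometric_of_lt_one (Real.exp_pos _).le h1).mul_left
      (Real.exp (-((m + 1) * s)))
    have e : Real.exp (-((m + 1) * s)) * (1 - Real.exp (-((m + 1) * s)))⁻¹ = kf ((m + 1) * s) := by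
      have h2 := (exp_sub_pos_s13 hx).ne'
      unfold kf
      rw [Real.exp_neg]
      have := (Real.exp_pos ((m + 1) * s)).ne'
      rw [← mul_inv, mul_sub, mul_one, mul_inv_cancel₀ this]
    rw [e] at this
    refine this.congr_fun ?_ |> id
    intro l
    rw [pow_succ']
  have hcol : ∀ l : ℕ, HasSum (fun m => f m l) (-Real.log (1 - Real.exp (-s * (l + 1)))) := by
    intro l
    have hx : 0 < s * ((l : ℝ) + 1) := by positivity
    have h1 : |Real.exp (-s * (l + 1))| < 1 := by
      rw [abs_of_pos (Real.exp_pos _)]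
      exact Real.exp_lt_one_iff.2 (by linarith)
    have := Real.hasSum_pow_div_log_of_abs_lt_one h1
    convert this using 2 with m
    simp only [hf]
    rw [← Real.exp_nat_mul, ← Real.exp_nat_mul]
    push_cast
    rw [one_div, mul_comm, ← div_eq_mul_inv]
    congr 2
    ring
  have hsum : Summable (Function.uncurry f) := by
    refine (summable_prod_of_nonneg ?_).2 ⟨fun m => (hrow m).summable, ?_⟩
    · rintro ⟨m, l⟩
      simp only [hf, Function.uncurry, Pi.zero_apply]
      positivity
    · exact (summable_kf_div hs).congr fun m => ((hrow m).tsum_eq).symm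
  have := hsum.tsum_comm
  unfold LOne
  rw [← tsum_neg, ← tsum_congr (fun l => (hcol l).tsum_eq), this,
    tsum_congr (fun m => (hrow m).tsum_eq)]

noncomputable def GG (c s : ℝ) : ℝ := ∑' n : ℕ, 1 / ((n : ℝ) + 1) * F0 c ((n + 1) * s)

lemma summable_F0 (c : ℝ) {s : ℝ} (hs : 0 < s) :
    Summable (fun n : ℕ => 1 / ((n : ℝ) + 1) * F0 c ((n + 1) * s)) := by
  refine ((summable_kf_div hs).add ((summable_kf hs).mul_left (c * s))).congr fun n => ?_
  unfold F0
  have hn : (0 : ℝ) < n + 1 := by positivity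
  field_simp

lemma LHat_eq {α t : ℝ} (hα : 0 < α) (ht : 0 < t) : LHat α t = GG (1 / (2 * α)) (α * t) := by
  have hs : 0 < α * t := by positivity
  unfold LHat GG
  rw [LOne_eq hs]
  have : DSum (α * t) = ∑' n : ℕ, kf ((n + 1) * (α * t)) := by
    unfold DSum kf
    simp only [one_div]
  rw [this, ← tsum_mul_left, ← (summable_kf_div hs).tsum_add ((summable_kf hs).mul_left (t / 2))]
  refine tsum_congr fun n => ?_
  unfold F0
  have hn : (0 : ℝ) < n + 1 := by positivity
  field_simp

lemma GG_deriv {c : ℝ} (hc : 0 < c) {s : ℝ} (hs : 0 < s) :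
    HasDerivAt (GG c) (∑' n : ℕ, F1 c ((n + 1) * s)) s ∧
    HasDerivAt (fun s => ∑' n : ℕ, F1 c ((n + 1) * s))
      (∑' n : ℕ, ((n : ℝ) + 1) * F2 c ((n + 1) * s)) s := by
  set a := s / 2 with ha
  have ha0 : 0 < a := by positivity
  have has : s ∈ Set.Ioi a := by simp only [Set.mem_Ioi, ha]; linarith
  obtain ⟨C, hC, hb⟩ := F1_bound hc ha0
  have hge : ∀ (n : ℕ) (y : ℝ), y ∈ Set.Ioi a → a ≤ ((n : ℝ) + 1) * y := by
    intro n y hy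
    have hy' : a < y := hy
    have hn : (0 : ℝ) ≤ n := by positivity
    nlinarith
  have hb1 : ∀ (n : ℕ) (y : ℝ), y ∈ Set.Ioi a → C / ((n + 1) * y) ^ 3 ≤
      C / a ^ 3 * (1 / ((n : ℝ) + 1) ^ 3) := by
    intro n y hy
    have hy' : a < y := hy
    calc _ ≤ C / ((n + 1) * a) ^ 3 := by gcongr
      _ = _ := by field_simp
  have hlin : ∀ (n : ℕ) (y : ℝ), HasDerivAt (fun y : ℝ => ((n : ℝ) + 1) * y) ((n : ℝ) + 1) y := by
    intro n y
    simpa using (hasDerivAt_id y).const_mul ((n : ℝ) + 1)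
  have hpos : ∀ (n : ℕ) (y : ℝ), y ∈ Set.Ioi a → 0 < ((n : ℝ) + 1) * y := fun n y hy =>
    ha0.trans_le (hge n y hy)
  have hbF1 : ∀ (n : ℕ) (y : ℝ), y ∈ Set.Ioi a → ‖F1 c ((n + 1) * y)‖ ≤
      C / a ^ 3 * (1 / ((n : ℝ) + 1) ^ 3) := fun n y hy =>
    ((hb _ (hge n y hy)).1).trans (hb1 n y hy)
  have hu1 := (summable_inv_pow 3 (by norm_num)).mul_left (C / a ^ 3)
  have hu2 := (summable_inv_pow 2 (by norm_num)).mul_left (C / a ^ 3)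
  constructor
  · refine hasDerivAt_tsum_of_isPreconnected (t := Set.Ioi a) (y₀ := s)
      (g := fun (n : ℕ) s => 1 / ((n : ℝ) + 1) * F0 c ((n + 1) * s))
      (g' := fun (n : ℕ) s => F1 c ((n + 1) * s)) hu1 isOpen_Ioi
      isPreconnected_Ioi ?_ hbF1 has (summable_F0 c hs) has
    intro n y hy
    have := ((hasDerivAt_F0 c (hpos n y hy)).comp y (hlin n y)).const_mul (1 / ((n : ℝ) + 1))
    refine this.congr_deriv ?_
    have hn : (0 : ℝ) < n + 1 := by positivity
    field_simp
  · refine hasDerivAt_tsum_of_isPreconnected (t := Set.Ioi a) (y₀ := s)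
      (g := fun (n : ℕ) s => F1 c ((n + 1) * s))
      (g' := fun (n : ℕ) s => ((n : ℝ) + 1) * F2 c ((n + 1) * s)) hu2 isOpen_Ioi
      isPreconnected_Ioi ?_ ?_ has (Summable.of_norm_bounded hu1 fun n => hbF1 n s has) has
    · intro n y hy
      have := (hasDerivAt_F1 c (hpos n y hy)).comp y (hlin n y)
      refine this.congr_deriv ?_
      ring
    · intro n y hy
      have hn : (0 : ℝ) < n + 1 := by positivity
      rw [norm_mul, Real.norm_eq_abs, Real.norm_eq_abs, abs_of_pos hn]
      calc _ ≤ ((n : ℝ) + 1) * (C / a ^ 3 * (1 / ((n : ℝ) + 1) ^ 3)) := by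
            gcongr
            exact ((hb _ (hge n y hy)).2).trans (hb1 n y hy)
        _ = _ := by field_simp

theorem stmt13 (α : ℝ) (hα : 1 < α) (hirr : Irrational α) :
    (fun t : ℝ => deriv (deriv (LHat α)) t - π ^ 2 / (3 * α * t ^ 3))
      =O[𝓝[>] (0 : ℝ)] (fun t => 1 / t ^ 2) := by
  have hα0 : 0 < α := by linarith
  set c := 1 / (2 * α) with hcdef
  have hc : 0 < c := by positivity
  have hlin : ∀ t : ℝ, HasDerivAt (fun y : ℝ => α * y) α t := by
    intro t
    simpa using (hasDerivAt_id t).const_mul α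
  have hd1 : ∀ t : ℝ, 0 < t → deriv (LHat α) t = α * ∑' n : ℕ, F1 c ((n + 1) * (α * t)) := by
    intro t ht
    have : LHat α =ᶠ[𝓝 t] fun t => GG c (α * t) := by
      filter_upwards [lt_mem_nhds ht] with y hy using LHat_eq hα0 hy
    rw [this.deriv_eq]
    have h := ((GG_deriv hc (mul_pos hα0 ht)).1.comp t (hlin t)).deriv
    rw [mul_comm]
    exact h
  have hd2 : ∀ t : ℝ, 0 < t → deriv (deriv (LHat α)) t =
      α ^ 2 * ∑' n : ℕ, ((n : ℝ) + 1) * F2 c ((n + 1) * (α * t)) := by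
    intro t ht
    have : deriv (LHat α) =ᶠ[𝓝 t] fun t => α * ∑' n : ℕ, F1 c ((n + 1) * (α * t)) := by
      filter_upwards [lt_mem_nhds ht] with y hy using hd1 y hy
    rw [this.deriv_eq]
    have h := (((GG_deriv hc (mul_pos hα0 ht)).2.comp t (hlin t)).const_mul α).deriv
    refine h.trans ?_
    ring
  obtain ⟨C, hC, hb⟩ := sum_bound hc
  refine IsBigO.of_bound C ?_
  filter_upwards [self_mem_nhdsWithin] with t ht
  have ht : 0 < t := ht
  have h := hb (α * t) (mul_pos hα0 ht)
  rw [hd2 t ht]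
  have e : π ^ 2 / (3 * α * t ^ 3) = α ^ 2 * (π ^ 2 / (3 * (α * t) ^ 3)) := by
    field_simp
  rw [e, ← mul_sub, norm_mul, Real.norm_eq_abs, Real.norm_eq_abs, Real.norm_eq_abs,
    abs_of_pos (by positivity : 0 < α ^ 2), abs_of_pos (by positivity : 0 < 1 / t ^ 2)]
  calc _ ≤ α ^ 2 * (C / (α * t) ^ 2) := by gcongr
    _ = _ := by field_simp
end
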